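/- Let S ⊆ ℝⁿ (n ≥ 2) be a centrally symmetric convex body of class C²₊ (C² boundary with everywhere strictly positive Gauss curvature). Then there is a nonnegative function ψ with ψ(Δ) → 0 as Δ → 0 such that for every x ∈ ∂S, every sufficiently small Δ > 0, and every y ∈ ℝⁿ with ⟨y, u(x)⟩ ≥ ⟨x, u(x)⟩ + Δ, one has ((2Δ)^{(n+1)/2}/(n(n+1)))·(|B₂^{n−1}|_{n−1}/κ(x)^{1/2})·(1 − ψ(Δ)) ≤ |conv(S ∪ {y})|ₙ − |S|ₙ. -/

import Mathlib

open MeasureTheory Metric Set Filter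
open scoped RealInnerProductSpace Pointwise Topology

noncomputable section

abbrev Euc (n : ℕ) : Type := EuclideanSpace ℝ (Fin n)

/-- A centrally symmetric convex body in `ℝⁿ`. -/
def IsSymConvexBody {n : ℕ} (S : Set (Euc n)) : Prop :=
  IsCompact S ∧ Convex ℝ S ∧ (interior S).Nonempty ∧ S = -S

/-- The convex floating body `K_δ`: the intersection of all closed halfspaces whose bounding
hyperplane cuts off a set of volume at most `δ·|K|ₙ` from `K`. -/
def floatingBody {n : ℕ} (K : Set (Euc n)) (δ : ℝ) : Set (Euc n) :=
  ⋂ (v : Euc n) (_ : v ≠ 0) (c : ℝ)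
    (_ : volume (K ∩ {y | c ≤ ⟪v, y⟫}) ≤ ENNReal.ofReal δ * volume K),
    {y | ⟪v, y⟫ ≤ c}

/-- The illumination body `K^δ`. -/
def illuminationBody {n : ℕ} (K : Set (Euc n)) (δ : ℝ) : Set (Euc n) :=
  {x | volume (convexHull ℝ (K ∪ {x})) ≤ ENNReal.ofReal (1 + δ) * volume K}

/-- The polar body `K°`. -/
def polarBody {n : ℕ} (K : Set (Euc n)) : Set (Euc n) :=
  {y | ∀ x ∈ K, ⟪x, y⟫ ≤ 1}

/-- The distance `d(C₁, C₂) = inf {a ≥ 1 : a⁻¹ C₁ ⊆ C₂ ⊆ a C₁}`. -/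
def bodyDist {n : ℕ} (C₁ C₂ : Set (Euc n)) : ℝ :=
  sInf {a : ℝ | 1 ≤ a ∧ a⁻¹ • C₁ ⊆ C₂ ∧ C₂ ⊆ a • C₁}

/-- `d_C(δ) = inf_{δ' > 0} d(C_δ, ((C°)^{δ'})°)`. -/
def dualDist {n : ℕ} (C : Set (Euc n)) (δ : ℝ) : ℝ :=
  sInf {r : ℝ | ∃ δ' > (0:ℝ), r = bodyDist (floatingBody C δ)
      (polarBody (illuminationBody (polarBody C) δ'))}

/-- `ν` is an outer unit normal of `S` at `x`. -/
def IsOuterNormalAt {n : ℕ} (S : Set (Euc n)) (x ν : Euc n) : Prop :=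
  ‖ν‖ = 1 ∧ ∀ y ∈ S, ⟪y, ν⟫ ≤ ⟪x, ν⟫

/-- Near `x ∈ ∂S`, the boundary of `S` is the graph of a `C²` function `f` over the tangent
hyperplane at `x` (embedded via a linear isometry `L` orthogonal to the normal `ν`), with
`f 0 = 0` and vanishing derivative at `0`, and `k` is the determinant of the Hessian of `f`
at `0`, i.e. the Gauss curvature of `∂S` at `x`. -/
def IsGaussCurvatureAt {n : ℕ} (S : Set (Euc n)) (x ν : Euc n) (k : ℝ) : Prop :=
  ∃ (L : Euc (n-1) →ₗᵢ[ℝ] Euc n) (f : Euc (n-1) → ℝ) (τ ε : ℝ),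
    0 < τ ∧ 0 < ε ∧
    (∀ v, ⟪L v, ν⟫ = 0) ∧
    ContDiffOn ℝ 2 f (ball 0 τ) ∧
    f 0 = 0 ∧ fderiv ℝ f 0 = 0 ∧
    frontier S ∩ ball x ε
      = {y | ∃ v ∈ ball (0 : Euc (n-1)) τ, y = x + L v - f v • ν} ∩ ball x ε ∧
    k = (Matrix.of fun i j : Fin (n-1) =>
      iteratedFDeriv ℝ 2 f 0 ![EuclideanSpace.single i 1, EuclideanSpace.single j 1]).det

/-- `S` has `C²` boundary, with outer unit normal map `u` and Gauss curvature function `κ`. -/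
def IsC2Body {n : ℕ} (S : Set (Euc n)) (u : Euc n → Euc n) (κ : Euc n → ℝ) : Prop :=
  ∀ x ∈ frontier S, IsOuterNormalAt S x (u x) ∧ IsGaussCurvatureAt S x (u x) (κ x)

/-- The constant `c(K, n) = ((n+1)^{2/(n+1)}/2)·(|K|ₙ/|B₂^{n−1}|_{n−1})^{2/(n+1)}`. -/
def cConst (n : ℕ) (K : Set (Euc n)) : ℝ :=
  ((n + 1 : ℝ) ^ ((2:ℝ)/(n+1)) / 2) *
    ((volume K).toReal / (volume (ball (0 : Euc (n-1)) 1)).toReal) ^ ((2:ℝ)/(n+1))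

/-- The function `G_S(x) = c(S,n)·κ(x)^{1/(n+1)} / ⟨x, u(x)⟩`. -/
def Gfun {n : ℕ} (S : Set (Euc n)) (u : Euc n → Euc n) (κ : Euc n → ℝ) (x : Euc n) : ℝ :=
  cConst n S * (κ x) ^ ((1:ℝ)/(n+1)) / ⟪x, u x⟫

section TangentCoordinates

variable {V E : Type*} [NormedAddCommGroup V] [InnerProductSpace ℝ V]
  [NormedAddCommGroup E] [InnerProductSpace ℝ E]

/-- The point with tangential coordinate `v` and depth `t` below the tangent hyperplane at `x`. -/
def tangentPoint (x : E) (L : V →ₗᵢ[ℝ] E) (ν : E) (p : V × ℝ) : E :=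
  x + L p.1 - p.2 • ν

theorem exists_isometryEquiv_eq_sub [FiniteDimensional ℝ V] [FiniteDimensional ℝ E]
    {L : V →ₗᵢ[ℝ] E} {ν : E} (hν : ‖ν‖ = 1) (hL : ∀ v, ⟪L v, ν⟫ = 0)
    (hd : Module.finrank ℝ E = Module.finrank ℝ V + 1) :
    ∃ Φ : WithLp 2 (V × ℝ) ≃ₗᵢ[ℝ] E, ∀ p, Φ p = L p.fst - p.snd • ν := by
  let A : WithLp 2 (V × ℝ) →ₗ[ℝ] E :=
    { toFun := fun p => L p.fst - p.snd • ν
      map_add' := by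
        intro p q
        simp only [WithLp.add_fst, WithLp.add_snd, map_add, add_smul]
        abel
      map_smul' := by
        intro c p
        simp [smul_sub, mul_smul] }
  have hA : ∀ p, ‖A p‖ = ‖p‖ := by
    intro p
    have h : ‖A p‖ ^ 2 = ‖p‖ ^ 2 := by
      rw [WithLp.prod_norm_sq_eq_of_L2]
      change ‖L p.fst - p.snd • ν‖ ^ 2 = _
      rw [norm_sub_sq_real, inner_smul_right, hL, norm_smul, hν, L.norm_map]
      simp
    exact (sq_eq_sq₀ (norm_nonneg _) (norm_nonneg _)).1 h
  have hf : Module.finrank ℝ (WithLp 2 (V × ℝ)) = Module.finrank ℝ E := by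
    rw [hd, (WithLp.linearEquiv 2 ℝ (V × ℝ)).finrank_eq, Module.finrank_prod,
      Module.finrank_self]
  exact ⟨LinearIsometry.toLinearIsometryEquiv ⟨A, hA⟩ hf, fun p => rfl⟩

variable {L : V →ₗᵢ[ℝ] E} {ν : E}

theorem norm_tangentPoint_sub_sq (x : E) (hν : ‖ν‖ = 1) (hL : ∀ v, ⟪L v, ν⟫ = 0) (p : V × ℝ) :
    ‖tangentPoint x L ν p - x‖ ^ 2 = ‖p.1‖ ^ 2 + p.2 ^ 2 := by
  have : tangentPoint x L ν p - x = L p.1 - p.2 • ν := by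
    simp only [tangentPoint]; abel
  rw [this, norm_sub_sq_real, inner_smul_right, hL, norm_smul, hν, L.norm_map]
  simp

theorem inner_tangentPoint (x : E) (p : V × ℝ) (u : E) :
    ⟪tangentPoint x L ν p, u⟫ = ⟪x, u⟫ + ⟪L p.1, u⟫ - p.2 * ⟪ν, u⟫ := by
  simp only [tangentPoint, inner_sub_left, inner_add_left, real_inner_smul_left]

variable [FiniteDimensional ℝ V] [FiniteDimensional ℝ E]

theorem tangentPoint_surjective (x : E) (hν : ‖ν‖ = 1) (hL : ∀ v, ⟪L v, ν⟫ = 0)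
    (hd : Module.finrank ℝ E = Module.finrank ℝ V + 1) :
    Function.Surjective (tangentPoint x L ν) := by
  obtain ⟨Φ, hΦ⟩ := exists_isometryEquiv_eq_sub hν hL hd
  intro y
  obtain ⟨p, hp⟩ := Φ.surjective (y - x)
  refine ⟨(p.fst, p.snd), ?_⟩
  rw [hΦ] at hp
  simp only [tangentPoint, add_sub_assoc, hp]
  abel

theorem volume_image_tangentPoint [MeasurableSpace V] [BorelSpace V] [MeasurableSpace E]
    [BorelSpace E] (x : E) (hν : ‖ν‖ = 1) (hL : ∀ v, ⟪L v, ν⟫ = 0)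
    (hd : Module.finrank ℝ E = Module.finrank ℝ V + 1) (D : Set (V × ℝ)) :
    volume (tangentPoint x L ν '' D) = volume D := by
  obtain ⟨Φ, hΦ⟩ := exists_isometryEquiv_eq_sub hν hL hd
  let e : V × ℝ ≃ᵐ E := ((MeasurableEquiv.toLp 2 (V × ℝ)).trans Φ.toMeasurableEquiv).trans
    (Homeomorph.addLeft x).toMeasurableEquiv
  have he : ∀ p, e p = tangentPoint x L ν p := by
    intro p
    change x + Φ (WithLp.toLp 2 p) = _
    rw [hΦ, tangentPoint, add_sub_assoc]
    rfl
  have hm : MeasurePreserving e := by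
    refine ((measurePreserving_add_left volume x).comp
      (Φ.measurePreserving.comp (WithLp.volume_preserving_toLp V ℝ)))
  have : tangentPoint x L ν '' D = e.symm ⁻¹' D := by
    rw [← MeasurableEquiv.image_eq_preimage_symm]
    exact image_congr fun p _ => (he p).symm
  rw [this, hm.symm.measure_preimage_equiv]

end TangentCoordinates

theorem integral_ball_one_sub_norm_sq {V : Type*} [NormedAddCommGroup V] [InnerProductSpace ℝ V]
    [FiniteDimensional ℝ V] [Nontrivial V] [MeasurableSpace V] [BorelSpace V] :
    ∫ z in ball (0 : V) 1, (1 - ‖z‖) ^ 2 =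
      2 / (((Module.finrank ℝ V : ℝ) + 1) * (Module.finrank ℝ V + 2)) *
        (volume : Measure V).real (ball 0 1) := by
  obtain ⟨k, hk⟩ : ∃ k, Module.finrank ℝ V = k + 1 :=
    ⟨Module.finrank ℝ V - 1, (Nat.succ_pred_eq_of_pos Module.finrank_pos).symm⟩
  have h1 : ∫ z in ball (0 : V) 1, (1 - ‖z‖) ^ 2 =
      ∫ z : V, (Iio (1 : ℝ)).indicator (fun r => (1 - r) ^ 2) ‖z‖ := by
    rw [← integral_indicator measurableSet_ball]
    congr 1
    ext z
    by_cases hz : ‖z‖ < 1 <;> simp [indicator, hz]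
  have h2 : ∫ y in Ioi (0 : ℝ), y ^ k • (Iio (1 : ℝ)).indicator (fun r => (1 - r) ^ 2) y =
      2 / (((k : ℝ) + 1) * (k + 2) * (k + 3)) := by
    have : ∀ y : ℝ, y ^ k • (Iio (1 : ℝ)).indicator (fun r => (1 - r) ^ 2) y =
        (Iio (1 : ℝ)).indicator (fun r => r ^ k - 2 * r ^ (k + 1) + r ^ (k + 2)) y := by
      intro y
      by_cases hy : y < 1
      · simp [indicator, hy]; ring
      · simp [indicator, hy]
    simp only [this]
    rw [setIntegral_indicator measurableSet_Iio, Ioi_inter_Iio, ← integral_Ioc_eq_integral_Ioo,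
      ← intervalIntegral.integral_of_le zero_le_one, intervalIntegral.integral_add,
      intervalIntegral.integral_sub, intervalIntegral.integral_const_mul, integral_pow,
      integral_pow, integral_pow]
    · push_cast
      field_simp
      simp
      ring
    all_goals exact Continuous.intervalIntegrable (by fun_prop) _ _
  rw [h1, integral_fun_norm_addHaar, hk, Nat.add_sub_cancel, h2, Measure.real]
  simp only [nsmul_eq_mul, smul_eq_mul]
  push_cast
  field_simp
  ring

section CapVolume

variable {V : Type*} [NormedAddCommGroup V] [InnerProductSpace ℝ V]
  [FiniteDimensional ℝ V] [Nontrivial V] [MeasurableSpace V] [BorelSpace V]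

/-- The region between the tangent cone of the paraboloid `(1 + η)‖T w‖² / 2` with apex at depth
`-h` and the paraboloid `(1 - η)‖T w‖² / 2`, over the affine function `a + ℓ w`. -/
def coneCapRegion (T : V ≃L[ℝ] V) (ℓ : V →L[ℝ] ℝ) (v₀ : V) (a h η R : ℝ) : Set (V × ℝ) :=
  regionBetween (fun v => a + ℓ (v - v₀) - h + 2 * h * ‖T (v - v₀)‖ / R)
    (fun v => a + ℓ (v - v₀) + (1 - η) / 2 * ‖T (v - v₀)‖ ^ 2) {v | ‖T (v - v₀)‖ < R}

theorem le_volume_coneCapRegion (T : V ≃L[ℝ] V) (ℓ : V →L[ℝ] ℝ) (v₀ : V) (a : ℝ) {h η R : ℝ}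
    (hh : 0 < h) (hη : 0 < η) (hR : 0 < R) (hRh : (1 + η) * R ^ 2 = 2 * h) :
    ENNReal.ofReal (R ^ Module.finrank ℝ V * h / |(T : V →L[ℝ] V).det| *
      ((2 / (((Module.finrank ℝ V : ℝ) + 1) * (Module.finrank ℝ V + 2)) - 2 * η) *
        (volume : Measure V).real (ball 0 1))) ≤ volume (coneCapRegion T ℓ v₀ a h η R) := by
  set B : Set V := {v | ‖T (v - v₀)‖ < R}
  have hB : MeasurableSet B := (isOpen_lt (by fun_prop) continuous_const).measurableSet
  set φ : V → ℝ := fun v => (1 - η) / 2 * ‖T (v - v₀)‖ ^ 2 + h - 2 * h * ‖T (v - v₀)‖ / R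
  have hφc : Continuous φ := by fun_prop
  let A : V →L[ℝ] V := R • (T.symm : V →L[ℝ] V)
  have himg : (fun z => v₀ + A z) '' ball 0 1 = B := by
    ext v
    simp only [mem_image, mem_ball, dist_zero_right, B, mem_ofPred_eq]
    constructor
    · rintro ⟨z, hz, rfl⟩
      simp only [A, add_sub_cancel_left, smul_apply, map_smul,
        ContinuousLinearEquiv.coe_coe, ContinuousLinearEquiv.apply_symm_apply, norm_smul,
        Real.norm_eq_abs, abs_of_pos hR]
      nlinarith
    · intro hv
      refine ⟨R⁻¹ • T (v - v₀), ?_, ?_⟩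
      · rw [norm_smul, Real.norm_eq_abs, abs_of_pos (inv_pos.2 hR), inv_mul_lt_iff₀ hR]
        simpa using hv
      · simp [A, hR.ne']
  have hinj : InjOn (fun z => v₀ + A z) (ball 0 1) := by
    intro z _ z' _ hzz
    simpa [A, hR.ne'] using hzz
  have hdet : |A.det| = R ^ Module.finrank ℝ V / |(T : V →L[ℝ] V).det| := by
    have h1 : A.det = R ^ Module.finrank ℝ V * (T.symm : V →L[ℝ] V).det := by
      simp only [A, ContinuousLinearMap.det, ContinuousLinearMap.toLinearMap_smul,
        LinearMap.det_smul]
    have h2 : (T.symm : V →L[ℝ] V).det * (T : V →L[ℝ] V).det = 1 := by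
      have := T.toLinearEquiv.det_symm_mul_det
      exact this
    have h3 : |(T.symm : V →L[ℝ] V).det| * |(T : V →L[ℝ] V).det| = 1 := by
      rw [← abs_mul, h2, abs_one]
    have h4 : |(T : V →L[ℝ] V).det| ≠ 0 := right_ne_zero_of_mul_eq_one h3
    rw [h1, abs_mul, abs_of_pos (pow_pos hR _), eq_div_iff h4, mul_assoc, h3, mul_one]
  have hint : ∫ v in B, φ v = |A.det| * ∫ z in ball (0 : V) 1, φ (v₀ + A z) := by
    rw [← himg, integral_image_eq_integral_abs_det_fderiv_smul volume measurableSet_ball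
      (fun z _ => (A.hasFDerivAt.const_add v₀).hasFDerivWithinAt) hinj]
    simp only [smul_eq_mul]
    rw [integral_const_mul]
  have hφA : ∀ z ∈ ball (0 : V) 1, h * (1 - ‖z‖) ^ 2 - 2 * η * h ≤ φ (v₀ + A z) := by
    intro z hz
    have hz1 : ‖z‖ < 1 := by simpa using hz
    have h0 := norm_nonneg z
    have hTz : ‖T (v₀ + A z - v₀)‖ = R * ‖z‖ := by
      simp [A, norm_smul, abs_of_pos hR]
    have h2 : φ (v₀ + A z) = h * (1 - ‖z‖) ^ 2 - η * R ^ 2 * ‖z‖ ^ 2 := by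
      simp only [φ, hTz]
      have : 2 * h * (R * ‖z‖) / R = 2 * h * ‖z‖ := by field_simp
      rw [this]
      linear_combination (‖z‖ ^ 2 / 2) * hRh
    rw [h2]
    have h3 : R ^ 2 * ‖z‖ ^ 2 ≤ 2 * h := by
      have : ‖z‖ ^ 2 ≤ 1 := by nlinarith
      nlinarith [sq_nonneg R]
    nlinarith
  have hball : IntegrableOn (fun z : V => φ (v₀ + A z)) (ball 0 1) :=
    ((show Continuous fun z : V => φ (v₀ + A z) by fun_prop).continuousOn.integrableOn_compact
      (isCompact_closedBall 0 1)).mono_set ball_subset_closedBall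
  have hball2 : IntegrableOn (fun z : V => h * (1 - ‖z‖) ^ 2) (ball 0 1) :=
    ((show Continuous fun z : V => h * (1 - ‖z‖) ^ 2 by fun_prop).continuousOn.integrableOn_compact
      (isCompact_closedBall 0 1)).mono_set ball_subset_closedBall
  have hlow : h * ((2 / (((Module.finrank ℝ V : ℝ) + 1) * (Module.finrank ℝ V + 2)) - 2 * η) *
      (volume : Measure V).real (ball 0 1)) ≤ ∫ z in ball (0 : V) 1, φ (v₀ + A z) := by
    have hc : IntegrableOn (fun _ : V => 2 * η * h) (ball 0 1) :=
      integrableOn_const (measure_ball_lt_top).ne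
    calc _ = ∫ z in ball (0 : V) 1, (h * (1 - ‖z‖) ^ 2 - 2 * η * h) := by
          rw [integral_sub hball2 hc, integral_const_mul, integral_ball_one_sub_norm_sq,
            setIntegral_const, smul_eq_mul]
          ring
      _ ≤ _ := setIntegral_mono_on (hball2.sub hc) hball measurableSet_ball hφA
  have hBb : IntegrableOn φ B := by
    rw [← himg]
    refine (hφc.continuousOn.integrableOn_compact
      ((isCompact_closedBall (0 : V) 1).image (f := fun z => v₀ + A z) (by fun_prop))).mono_set
      (image_mono ball_subset_closedBall)
  have hvol : volume (coneCapRegion T ℓ v₀ a h η R) = ∫⁻ v in B, ENNReal.ofReal (φ v) := by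
    rw [coneCapRegion, Measure.volume_eq_prod, volume_regionBetween_eq_lintegral
      (Continuous.aemeasurable (by fun_prop)) (Continuous.aemeasurable (by fun_prop)) hB]
    congr 1
    ext v
    congr 1
    simp only [Pi.sub_apply, φ]
    ring
  rw [hvol]
  calc _ ≤ ENNReal.ofReal (∫ v in B, φ v) := by
        apply ENNReal.ofReal_le_ofReal
        rw [hint, hdet]
        calc _ = R ^ Module.finrank ℝ V / |(T : V →L[ℝ] V).det| * (h *
              ((2 / (((Module.finrank ℝ V : ℝ) + 1) * (Module.finrank ℝ V + 2)) - 2 * η) *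
              (volume : Measure V).real (ball 0 1))) := by ring
          _ ≤ _ := by gcongr
    _ ≤ ENNReal.ofReal (∫ v in B, max (φ v) 0) := by
        apply ENNReal.ofReal_le_ofReal
        exact setIntegral_mono hBb hBb.pos_part fun v => le_max_left _ _
    _ = ∫⁻ v in B, ENNReal.ofReal (φ v) := by
        rw [ofReal_integral_eq_lintegral_ofReal hBb.pos_part
          (Eventually.of_forall fun v => le_max_right _ _)]
        simp

end CapVolume

section Excess

variable {V E : Type*} [NormedAddCommGroup V] [InnerProductSpace ℝ V]
  [NormedAddCommGroup E] [InnerProductSpace ℝ E]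

theorem convex_tangentPoint_segment {K : Set E} (hK : Convex ℝ K) {x ν : E} {L : V →ₗᵢ[ℝ] E}
    {v : V} {a b t : ℝ} (ha : tangentPoint x L ν (v, a) ∈ K) (hb : tangentPoint x L ν (v, b) ∈ K)
    (hat : a ≤ t) (htb : t ≤ b) : tangentPoint x L ν (v, t) ∈ K := by
  have hseg : t ∈ segment ℝ a b := by
    rw [segment_eq_Icc (hat.trans htb)]; exact ⟨hat, htb⟩
  obtain ⟨c, d, hc, hd, hcd, rfl⟩ := hseg
  convert! hK ha hb hc hd hcd using 1
  obtain rfl : d = 1 - c := by linarith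
  simp only [tangentPoint, smul_eq_mul]
  module

theorem tangentPoint_lineMap_smul (x ν : E) (L : V →ₗᵢ[ℝ] E) (v w : V) (a b s : ℝ) (hs : s ≠ 0) :
    (1 - s) • tangentPoint x L ν (v, a) + s • tangentPoint x L ν (v + s⁻¹ • w, b) =
      tangentPoint x L ν (v + w, (1 - s) * a + s * b) := by
  have : s • L (s⁻¹ • w) = L w := by
    rw [map_smul, smul_smul, mul_inv_cancel₀ hs, one_smul]
  simp only [tangentPoint, map_add, smul_add, smul_sub, this]
  module

theorem coneCapRegion_image_subset {K : Set E} (hK : Convex ℝ K) {x ν : E} {L : V →ₗᵢ[ℝ] E}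
    {f : V → ℝ} {ℓ : V →L[ℝ] ℝ} {T : V ≃L[ℝ] V} {v₀ : V} {h η R : ℝ} (hR : 0 < R)
    (hRh : (1 + η) * R ^ 2 = 2 * h)
    (hg : ∀ w, ‖T w‖ ≤ R → |f (v₀ + w) - f v₀ - ℓ w - ‖T w‖ ^ 2 / 2| ≤ η / 2 * ‖T w‖ ^ 2)
    (hmem : ∀ w, ‖T w‖ ≤ R → tangentPoint x L ν (v₀ + w, f (v₀ + w)) ∈ K)
    (hy : tangentPoint x L ν (v₀, f v₀ - h) ∈ K) :
    tangentPoint x L ν '' coneCapRegion T ℓ v₀ (f v₀) h η R ⊆ K := by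
  rintro _ ⟨⟨v, t⟩, ⟨hv, ht1, ht2⟩, rfl⟩
  obtain ⟨w, rfl⟩ : ∃ w, v = v₀ + w := ⟨v - v₀, by abel⟩
  simp only [add_sub_cancel_left, mem_ofPred_eq] at hv ht1 ht2
  have hup := hmem w hv.le
  have hgw := (abs_le.1 (hg w hv.le)).1
  refine convex_tangentPoint_segment hK (a := f v₀ + ℓ w - h + 2 * h * ‖T w‖ / R) ?_ hup ht1.le
    (by linarith)
  rcases eq_or_ne w 0 with rfl | hw
  · simpa using hy
  have hTw : 0 < ‖T w‖ := by simpa using hw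
  set s : ℝ := ‖T w‖ / R with hs
  have hs0 : 0 < s := by positivity
  have hs1 : s < 1 := (div_lt_one hR).2 hv
  have hTs : ‖T (s⁻¹ • w)‖ = R := by
    rw [map_smul, norm_smul, Real.norm_eq_abs, abs_of_pos (inv_pos.2 hs0), hs]
    field_simp
  have hgs := (abs_le.1 (hg (s⁻¹ • w) hTs.le)).2
  rw [hTs, map_smul, smul_eq_mul] at hgs
  have hq := hK hy (hmem (s⁻¹ • w) hTs.le) (sub_nonneg.2 hs1.le) hs0.le (by ring)
  rw [tangentPoint_lineMap_smul _ _ _ _ _ _ _ _ hs0.ne'] at hq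
  refine convex_tangentPoint_segment hK hq hup ?_ (by linarith)
  have e1 : s * (s⁻¹ * ℓ w) = ℓ w := by field_simp
  have e2 : 2 * h * ‖T w‖ / R = 2 * h * s := by rw [hs]; ring
  rw [e2]
  nlinarith [mul_le_mul_of_nonneg_left hgs hs0.le]

variable [FiniteDimensional ℝ V] [Nontrivial V] [MeasurableSpace V] [BorelSpace V]
  [FiniteDimensional ℝ E] [MeasurableSpace E] [BorelSpace E]

theorem le_volume_convexHull_sub {S : Set E} (hS : IsCompact S) {x ν : E} {L : V →ₗᵢ[ℝ] E}
    (hν : ‖ν‖ = 1) (hL : ∀ v, ⟪L v, ν⟫ = 0)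
    (hd : Module.finrank ℝ E = Module.finrank ℝ V + 1)
    {f : V → ℝ} {ℓ : V →L[ℝ] ℝ} {T : V ≃L[ℝ] V} {v₀ : V} {h η R : ℝ}
    (hh : 0 < h) (hη : 0 < η) (hR : 0 < R) (hRh : (1 + η) * R ^ 2 = 2 * h)
    (hg : ∀ w, ‖T w‖ ≤ R → |f (v₀ + w) - f v₀ - ℓ w - ‖T w‖ ^ 2 / 2| ≤ η / 2 * ‖T w‖ ^ 2)
    (hmem : ∀ w, ‖T w‖ ≤ R → tangentPoint x L ν (v₀ + w, f (v₀ + w)) ∈ S)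
    (hnot : ∀ w, ‖T w‖ ≤ R → ∀ t < f (v₀ + w), tangentPoint x L ν (v₀ + w, t) ∉ S) :
    R ^ Module.finrank ℝ V * h / |(T : V →L[ℝ] V).det| *
      ((2 / (((Module.finrank ℝ V : ℝ) + 1) * (Module.finrank ℝ V + 2)) - 2 * η) *
        (volume : Measure V).real (ball 0 1)) ≤
    (volume (convexHull ℝ (S ∪ {tangentPoint x L ν (v₀, f v₀ - h)}))).toReal -
      (volume S).toReal := by
  set y := tangentPoint x L ν (v₀, f v₀ - h)
  set K := convexHull ℝ (S ∪ {y})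
  set D := tangentPoint x L ν '' coneCapRegion T ℓ v₀ (f v₀) h η R
  have hSK : S ⊆ K := subset_union_left.trans (subset_convexHull ℝ _)
  have hyK : y ∈ K := subset_convexHull ℝ _ (Or.inr rfl)
  have hDK : D ⊆ K := coneCapRegion_image_subset (convex_convexHull ℝ _) hR hRh hg
    (fun w hw => hSK (hmem w hw)) hyK
  have hdisj : Disjoint D S := by
    rw [Set.disjoint_left]
    rintro _ ⟨⟨v, t⟩, ⟨hv, ht1, ht2⟩, rfl⟩
    obtain ⟨w, rfl⟩ : ∃ w, v = v₀ + w := ⟨v - v₀, by abel⟩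
    simp only [add_sub_cancel_left, mem_ofPred_eq] at hv ht1 ht2
    exact hnot w hv.le t (by linarith [(abs_le.1 (hg w hv.le)).1])
  have hKfin : volume K ≠ ⊤ := by
    refine (Bornology.IsBounded.measure_lt_top ?_).ne
    exact isBounded_convexHull.2 (hS.isBounded.union Bornology.isBounded_singleton)
  have hsum : volume D + volume S ≤ volume K := by
    rw [← measure_union hdisj hS.measurableSet]
    exact measure_mono (union_subset hDK hSK)
  have hSfin : volume S ≠ ⊤ := ((measure_mono hSK).trans_lt hKfin.lt_top).ne
  have hDfin : volume D ≠ ⊤ := ((measure_mono hDK).trans_lt hKfin.lt_top).ne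
  have h1 := ENNReal.toReal_mono hKfin hsum
  rw [ENNReal.toReal_add hDfin hSfin] at h1
  have h2 := le_volume_coneCapRegion T ℓ v₀ (f v₀) hh hη hR hRh
  rw [← volume_image_tangentPoint x hν hL hd] at h2
  have h3 := (ENNReal.ofReal_le_iff_le_toReal hDfin).1 h2
  linarith

end Excess

section SecondOrder

theorem exists_taylor_two_bound {V : Type*} [NormedAddCommGroup V] [NormedSpace ℝ V] {f : V → ℝ}
    (hf : ContDiffAt ℝ 2 f 0) {c : ℝ} (hc : 0 < c) :
    ∃ ρ > 0, ∀ v w : V, ‖v‖ < ρ → ‖w‖ < ρ →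
      |f (v + w) - f v - fderiv ℝ f v w - fderiv ℝ (fderiv ℝ f) 0 w w / 2| ≤ c * ‖w‖ ^ 2 := by
  set A := fderiv ℝ (fderiv ℝ f) 0
  have hsymm : ∀ a b, A a b = A b a := hf.isSymmSndFDerivAt (by simp)
  have h1 : ContDiffAt ℝ 1 (fderiv ℝ f) 0 := hf.fderiv_right (by norm_num)
  have h2 : HasStrictFDerivAt (fderiv ℝ f) A 0 := h1.hasStrictFDerivAt (by norm_num)
  have h3 := h2.isLittleO.def hc
  have hd : ∀ᶠ z in 𝓝 (0 : V), DifferentiableAt ℝ f z :=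
    (hf.eventually (by simp)).mono fun z hz => hz.differentiableAt (by norm_num)
  rw [nhds_prod_eq] at h3
  obtain ⟨p, hp, q, hq, hpq⟩ := eventually_prod_iff.1 h3
  obtain ⟨r, hr, hball⟩ := Metric.eventually_nhds_iff.1 (hd.and (hp.and hq))
  simp only [dist_zero_right] at hball
  refine ⟨r / 2, by positivity, fun v w hv hw => ?_⟩
  set G : V → ℝ := fun z => f (v + z) - fderiv ℝ f v z - A z z / 2
  have hG : ∀ z ∈ closedBall (0 : V) ‖w‖, HasFDerivWithinAt G (fderiv ℝ f (v + z) - fderiv ℝ f v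
      - A z) (closedBall (0 : V) ‖w‖) z := by
    intro z hz
    have hz' : ‖z‖ < r / 2 := (mem_closedBall_zero_iff.1 hz).trans_lt hw
    have hvz : ‖v + z‖ < r := (norm_add_le _ _).trans_lt (by linarith)
    have e1 : HasFDerivAt (fun z => f (v + z)) (fderiv ℝ f (v + z)) z := by
      have := (hball hvz).1.hasFDerivAt.comp z ((hasFDerivAt_id z).const_add v)
      simpa using! this
    have e2 : HasFDerivAt (fun z => A z z / 2) (A z) z := by
      have := ((A.hasFDerivAt (x := z)).clm_apply (hasFDerivAt_id z)).mul_const (2 : ℝ)⁻¹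
      refine (this.congr_fderiv ?_).congr_of_eventuallyEq (Eventually.of_forall fun z => ?_)
      · ext b
        simp [hsymm b z]
        ring
      · simp [div_eq_mul_inv]
    exact ((e1.sub (fderiv ℝ f v).hasFDerivAt).sub e2).hasFDerivWithinAt
  have hb : ∀ z ∈ closedBall (0 : V) ‖w‖, ‖fderiv ℝ f (v + z) - fderiv ℝ f v - A z‖ ≤
      c * ‖w‖ := by
    intro z hz
    have hz0 := mem_closedBall_zero_iff.1 hz
    have hz' : ‖z‖ < r / 2 := hz0.trans_lt hw
    have hvz : ‖v + z‖ < r := (norm_add_le _ _).trans_lt (by linarith)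
    have := hpq (hball hvz).2.1 (hball (show ‖v‖ < r by linarith)).2.2
    simp only [add_sub_cancel_left] at this
    exact this.trans (by gcongr)
  have := (convex_closedBall (0 : V) ‖w‖).norm_image_sub_le_of_norm_hasFDerivWithin_le hG hb
    (mem_closedBall_self (norm_nonneg w)) (mem_closedBall_zero_iff.2 le_rfl)
  simp only [G, add_zero, map_zero, sub_zero, Real.norm_eq_abs, zero_div] at this
  calc _ = |f (v + w) - fderiv ℝ f v w - A w w / 2 - f v| := by congr 1; ring
    _ ≤ c * ‖w‖ * ‖w‖ := this
    _ = c * ‖w‖ ^ 2 := by ring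

open scoped MatrixOrder ComplexOrder in
theorem exists_equiv_norm_sq_eq {m : ℕ} (A : Euc m →L[ℝ] Euc m →L[ℝ] ℝ)
    (hsymm : ∀ a b, A a b = A b a) (hpos : ∀ a, 0 ≤ A a a) {k : ℝ} (hk : 0 < k)
    (hdet : k = (Matrix.of fun i j : Fin m =>
      A (EuclideanSpace.single i 1) (EuclideanSpace.single j 1)).det) :
    ∃ T : Euc m ≃L[ℝ] Euc m, (∀ w, A w w = ‖T w‖ ^ 2) ∧ (T : Euc m →L[ℝ] Euc m).det ^ 2 = k := by
  set H : Matrix (Fin m) (Fin m) ℝ := Matrix.of fun i j : Fin m =>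
      A (EuclideanSpace.single i 1) (EuclideanSpace.single j 1)
  have hquad : ∀ w : Euc m, A w w = star w.ofLp ⬝ᵥ H.mulVec w.ofLp := by
    intro w
    have hw : w = ∑ i, w i • EuclideanSpace.single i (1 : ℝ) := by
      simpa using! ((EuclideanSpace.basisFun (Fin m) ℝ).sum_repr w).symm
    conv_lhs => rw [hw]
    simp only [map_sum, map_smul, sum_apply, smul_apply, smul_eq_mul, dotProduct,
      Matrix.mulVec, H, Matrix.of_apply, star_trivial, Finset.mul_sum]
    rw [Finset.sum_comm]
    refine Finset.sum_congr rfl fun i _ => Finset.sum_congr rfl fun j _ => ?_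
    ring
  have hH : H.PosSemidef := by
    refine .of_dotProduct_mulVec_nonneg ?_ fun x => ?_
    · ext i j
      simp [H, hsymm]
    · have := hpos (WithLp.toLp 2 x)
      rwa [hquad] at this
  obtain ⟨B, hB⟩ := CStarAlgebra.nonneg_iff_eq_star_mul_self.mp hH.nonneg
  have hBdet : B.det ^ 2 = k := by
    rw [hdet, hB, Matrix.star_eq_conjTranspose, Matrix.det_mul, Matrix.det_conjTranspose,
      star_trivial, sq]
  have hB0 : B.det ≠ 0 := by
    rintro h
    rw [h] at hBdet
    norm_num at hBdet
    exact hk.ne hBdet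
  set M : Euc m →ₗ[ℝ] Euc m := Matrix.toEuclideanLin B
  have hM : LinearMap.det M = B.det := by
    simp only [M, Matrix.toEuclideanLin_eq_toLin_orthonormal, LinearMap.det_toLin]
  let T : Euc m ≃L[ℝ] Euc m :=
    (LinearMap.equivOfDetNeZero M (by rwa [hM])).toContinuousLinearEquiv
  refine ⟨T, fun w => ?_, ?_⟩
  · have h1 : T w = WithLp.toLp 2 (B.mulVec w.ofLp) := rfl
    rw [hquad, hB, h1, EuclideanSpace.real_norm_sq_eq, ← Matrix.mulVec_mulVec,
      Matrix.dotProduct_mulVec, Matrix.star_eq_conjTranspose, Matrix.vecMul_conjTranspose]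
    simp [dotProduct, sq]
  · rw [← hBdet, ← hM]
    rfl

end SecondOrder

section OsculatingChart

/-- A graph chart of `∂S` over its tangent hyperplane at `x` with normal `ν`, in which the second
order Taylor polynomial of the graph function at `0` is `‖T v‖² / 2`. -/
structure OsculatingChart {m : ℕ} (S : Set (Euc (m + 1))) (x ν : Euc (m + 1)) where
  L : Euc m →ₗᵢ[ℝ] Euc (m + 1)
  f : Euc m → ℝ
  ℓ : Euc m → Euc m →L[ℝ] ℝ
  T : Euc m ≃L[ℝ] Euc m
  inner_L : ∀ v, ⟪L v, ν⟫ = 0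
  f_zero : f 0 = 0
  ℓ_zero : ℓ 0 = 0
  hasFDerivAt : ∃ ρ > 0, ∀ v, ‖v‖ < ρ → HasFDerivAt f (ℓ v) v
  taylor : ∀ η > 0, ∃ ρ > 0, ∀ v w, ‖v‖ < ρ → ‖w‖ < ρ →
    |f (v + w) - f v - ℓ v w - ‖T w‖ ^ 2 / 2| ≤ η * ‖T w‖ ^ 2
  graph_mem : ∃ ρ > 0, ∀ v, ‖v‖ < ρ → tangentPoint x L ν (v, f v) ∈ frontier S
  exists_coord : ∃ ρ > 0, ∀ z ∈ frontier S, ‖z - x‖ < ρ →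
    ∃ v, ‖v‖ ≤ ‖z - x‖ ∧ z = tangentPoint x L ν (v, f v)

theorem continuous_tangentPoint {V E : Type*} [NormedAddCommGroup V] [InnerProductSpace ℝ V]
    [NormedAddCommGroup E] [InnerProductSpace ℝ E] (x ν : E) (L : V →ₗᵢ[ℝ] E) :
    Continuous (tangentPoint x L ν) := by
  have := L.continuous
  unfold tangentPoint
  fun_prop

theorem tangentPoint_zero {V E : Type*} [NormedAddCommGroup V] [InnerProductSpace ℝ V]
    [NormedAddCommGroup E] [InnerProductSpace ℝ E] (x ν : E) (L : V →ₗᵢ[ℝ] E) :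
    tangentPoint x L ν (0, 0) = x := by
  simp [tangentPoint]

theorem exists_ball_of_eventually {m : ℕ} {p : Euc m → Prop} (h : ∀ᶠ v in 𝓝 0, p v) :
    ∃ ρ > 0, ∀ v, ‖v‖ < ρ → p v := by
  simpa using Metric.eventually_nhds_iff.1 h

theorem exists_osculatingChart {m : ℕ} {S : Set (Euc (m + 1))} (hS : IsClosed S)
    {x ν : Euc (m + 1)} {k : ℝ} (hν : IsOuterNormalAt S x ν) (hG : IsGaussCurvatureAt S x ν k)
    (hk : 0 < k) :
    ∃ C : OsculatingChart S x ν, (C.T : Euc m →L[ℝ] Euc m).det ^ 2 = k := by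
  obtain ⟨L, f, τ, ε, hτ, hε, hL, hf, hf0, hdf0, hfr, hk'⟩ := hG
  change Euc m →ₗᵢ[ℝ] Euc (m + 1) at L
  change Euc m → ℝ at f
  have hfr' : frontier S ∩ ball x ε = {y | ∃ v ∈ ball (0 : Euc m) τ,
    y = tangentPoint x L ν (v, f v)} ∩ ball x ε := hfr
  have hnhds : ball (0 : Euc m) τ ∈ 𝓝 0 := ball_mem_nhds _ hτ
  have hf2 : ContDiffAt ℝ 2 f 0 := hf.contDiffAt hnhds
  have hgraph : ∀ᶠ v in 𝓝 (0 : Euc m), tangentPoint x L ν (v, f v) ∈ frontier S := by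
    have hc : Tendsto (fun v => tangentPoint x L ν (v, f v)) (𝓝 0) (𝓝 x) := by
      have h1 : ContinuousAt (fun v => tangentPoint x L ν (v, f v)) 0 :=
        (continuous_tangentPoint x ν L).continuousAt.comp
          (continuousAt_id.prodMk hf2.continuousAt)
      simpa [ContinuousAt, hf0, tangentPoint_zero] using h1
    filter_upwards [hc (ball_mem_nhds x hε), hnhds] with v hv hvτ
    have : tangentPoint x L ν (v, f v) ∈ frontier S ∩ ball x ε := by
      rw [hfr']; exact ⟨⟨v, hvτ, rfl⟩, hv⟩
    exact this.1
  have hnonneg : ∀ᶠ v in 𝓝 (0 : Euc m), 0 ≤ f v := by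
    filter_upwards [hgraph] with v hv
    have := hν.2 _ (hS.frontier_subset hv)
    rw [inner_tangentPoint, hL, real_inner_self_eq_norm_sq, hν.1] at this
    linarith
  set A := fderiv ℝ (fderiv ℝ f) 0
  have hsymm : ∀ a b, A a b = A b a := hf2.isSymmSndFDerivAt (by simp)
  have hpos : ∀ a, 0 ≤ A a a := by
    intro a
    by_contra! hneg
    have ha : a ≠ 0 := by rintro rfl; simp at hneg
    have hc : 0 < -A a a / (4 * ‖a‖ ^ 2) := by
      have := norm_pos_iff.2 ha
      have : 0 < -A a a := by linarith
      positivity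
    obtain ⟨ρ, hρ, hT⟩ := exists_taylor_two_bound hf2 hc
    have h1 : Tendsto (fun s : ℝ => s • a) (𝓝[>] 0) (𝓝 0) := by
      have : Continuous fun s : ℝ => s • a := by fun_prop
      simpa using (this.tendsto 0).mono_left nhdsWithin_le_nhds
    obtain ⟨s, ⟨hs1, hs2⟩, hs3⟩ := (((h1.eventually hnonneg).and
      (h1.eventually (eventually_norm_sub_lt 0 hρ))).and self_mem_nhdsWithin).exists
    have hs3' : 0 < s := hs3
    have := (abs_le.1 (hT 0 (s • a) (by simpa using hρ) (by simpa using hs2))).2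
    rw [zero_add, hf0, hdf0] at this
    change f (s • a) - 0 - 0 - A (s • a) (s • a) / 2 ≤ _ at this
    have e1 : A (s • a) (s • a) = s ^ 2 * A a a := by
      simp only [map_smul, smul_apply, smul_eq_mul]; ring
    have e2 : -A a a / (4 * ‖a‖ ^ 2) * ‖s • a‖ ^ 2 = s ^ 2 * (-A a a / 4) := by
      have := norm_ne_zero_iff.2 ha
      rw [norm_smul, mul_pow, Real.norm_eq_abs, sq_abs]
      field_simp
    rw [e1, e2] at this
    nlinarith [pow_pos hs3' 2]
  obtain ⟨T, hT, hdet⟩ := exists_equiv_norm_sq_eq A hsymm hpos hk (by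
    rw [hk']
    congr 1
    ext i j
    simp only [Matrix.of_apply]
    exact iteratedFDeriv_two_apply f 0 _)
  refine ⟨⟨L, f, fderiv ℝ f, T, hL, hf0, hdf0, ⟨τ, hτ, fun v hv => ?_⟩, fun η hη => ?_,
    exists_ball_of_eventually hgraph, ⟨ε, hε, fun z hz hzx => ?_⟩⟩, hdet⟩
  · exact ((hf.contDiffAt (isOpen_ball.mem_nhds (mem_ball_zero_iff.2 hv))).differentiableAt
      (by norm_num)).hasFDerivAt
  · set K := ‖(T.symm : Euc m →L[ℝ] Euc m)‖ + 1
    have hK : 0 < K := by positivity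
    obtain ⟨ρ, hρ, h⟩ := exists_taylor_two_bound hf2 (c := η / K ^ 2) (by positivity)
    refine ⟨ρ, hρ, fun v w hv hw => ?_⟩
    rw [← hT]
    refine (h v w hv hw).trans ?_
    rw [hT, div_mul_eq_mul_div, mul_div_assoc]
    gcongr
    rw [div_le_iff₀ (by positivity), ← mul_pow]
    gcongr
    calc ‖w‖ = ‖(T.symm : Euc m →L[ℝ] Euc m) (T w)‖ := by simp
      _ ≤ ‖(T.symm : Euc m →L[ℝ] Euc m)‖ * ‖T w‖ := ContinuousLinearMap.le_opNorm _ _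
      _ ≤ ‖T w‖ * K := by
        rw [mul_comm]
        gcongr
        simp [K]
  · have : z ∈ frontier S ∩ ball x ε := ⟨hz, by rwa [mem_ball, dist_eq_norm]⟩
    rw [hfr'] at this
    obtain ⟨⟨v, -, rfl⟩, -⟩ := this
    refine ⟨v, ?_, rfl⟩
    have h := norm_tangentPoint_sub_sq x hν.1 hL (v, f v)
    refine le_of_sq_le_sq ?_ (norm_nonneg _)
    rw [h]
    simp only
    nlinarith [sq_nonneg (f v)]

namespace OsculatingChart

variable {m : ℕ} {S : Set (Euc (m + 1))} {x ν : Euc (m + 1)}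

/-- The boundary point over the tangential coordinate `v`. -/
def point (C : OsculatingChart S x ν) (v : Euc m) : Euc (m + 1) :=
  tangentPoint x C.L ν (v, C.f v)

theorem point_zero (C : OsculatingChart S x ν) : C.point 0 = x := by
  rw [point, C.f_zero, tangentPoint_zero]

theorem continuousAt_f (C : OsculatingChart S x ν) : ContinuousAt C.f 0 := by
  obtain ⟨ρ, hρ, h⟩ := C.hasFDerivAt
  exact (h 0 (by simpa using hρ)).continuousAt

theorem tendsto_point (C : OsculatingChart S x ν) : Tendsto C.point (𝓝 0) (𝓝 x) := by
  have h1 : ContinuousAt C.point 0 := (continuous_tangentPoint x ν C.L).continuousAt.comp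
    (continuousAt_id.prodMk C.continuousAt_f)
  simpa [ContinuousAt, C.point_zero] using h1

theorem eventually_point_mem_frontier (C : OsculatingChart S x ν) :
    ∀ᶠ v in 𝓝 0, C.point v ∈ frontier S := by
  obtain ⟨ρ, hρ, h⟩ := C.graph_mem
  exact Metric.eventually_nhds_iff.2 ⟨ρ, hρ, fun v hv => h v (by simpa using hv)⟩

theorem tendsto_point_frontier (C : OsculatingChart S x ν) :
    Tendsto C.point (𝓝 0) (𝓝[frontier S] x) :=
  tendsto_nhdsWithin_iff.2 ⟨C.tendsto_point, C.eventually_point_mem_frontier⟩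

theorem exists_inner_L_eq (C : OsculatingChart S x ν) (hS : IsClosed S) :
    ∃ ρ > 0, ∀ v, ‖v‖ < ρ → ∀ u, IsOuterNormalAt S (C.point v) u →
      ∀ w, ⟪C.L w, u⟫ = C.ℓ v w * ⟪ν, u⟫ := by
  obtain ⟨ρ₁, hρ₁, h₁⟩ := C.hasFDerivAt
  obtain ⟨ρ₂, hρ₂, h₂⟩ := C.graph_mem
  refine ⟨min ρ₁ ρ₂, lt_min hρ₁ hρ₂, fun v hv u hu w => ?_⟩
  let F : Euc m → ℝ := fun z => ⟪C.L z, u⟫ - C.f z * ⟪ν, u⟫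
  have hmax : IsLocalMax F v := by
    have hopen : ∀ᶠ z in 𝓝 v, ‖z‖ < ρ₂ :=
      (isOpen_lt continuous_norm continuous_const).mem_nhds (hv.trans_le (min_le_right _ _))
    filter_upwards [hopen] with z hz
    have := hu.2 _ (hS.frontier_subset (h₂ z hz))
    rw [point, inner_tangentPoint, inner_tangentPoint] at this
    simp only [F]
    linarith
  have hL : HasFDerivAt (fun z => ⟪C.L z, u⟫)
      ((innerSL ℝ u).comp C.L.toContinuousLinearMap) v := by
    refine ((innerSL ℝ u).comp C.L.toContinuousLinearMap).hasFDerivAt.congr_of_eventuallyEq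
      (Eventually.of_forall fun z => ?_)
    simp [real_inner_comm]
  have hF : HasFDerivAt F _ v := hL.sub ((h₁ v (hv.trans_le (min_le_left _ _))).mul_const ⟪ν, u⟫)
  have h0 := congrArg (fun g : Euc m →L[ℝ] ℝ => g w) (hmax.hasFDerivAt_eq_zero hF)
  simp only [sub_apply, ContinuousLinearMap.comp_apply, innerSL_apply_apply, smul_apply,
    smul_eq_mul, zero_apply, LinearIsometry.coe_toContinuousLinearMap] at h0
  rw [real_inner_comm]
  linarith

theorem eq_normal (C : OsculatingChart S x ν) (hS : IsClosed S) (hint : (interior S).Nonempty)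
    (hν : IsOuterNormalAt S x ν) {u : Euc (m + 1)} (hu : IsOuterNormalAt S x u) : u = ν := by
  obtain ⟨ρ, hρ, h⟩ := C.exists_inner_L_eq hS
  have hL0 : ∀ w, ⟪C.L w, u⟫ = 0 := by
    intro w
    have := h 0 (by simpa using hρ) u (by rwa [C.point_zero]) w
    simpa [C.ℓ_zero] using this
  obtain ⟨⟨v, t⟩, hvt⟩ := tangentPoint_surjective 0 hν.1 C.inner_L (by simp) u
  have hv : v = 0 := by
    have := hL0 v
    rw [← hvt, real_inner_comm, inner_tangentPoint, real_inner_comm, real_inner_comm _ ν,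
      C.inner_L, real_inner_self_eq_norm_sq, C.L.norm_map] at this
    simpa using this
  have hut : u = -(t • ν) := by rw [← hvt, hv]; simp [tangentPoint]
  have ht : |t| = 1 := by
    have := hu.1
    rwa [hut, norm_neg, norm_smul, hν.1, mul_one] at this
  rcases (abs_eq zero_le_one).1 ht with rfl | rfl
  · exfalso
    obtain ⟨z, hz⟩ := hint
    have hc : Tendsto (fun s : ℝ => z - s • ν) (𝓝[>] 0) (𝓝 z) := by
      have : Continuous fun s : ℝ => z - s • ν := by fun_prop
      simpa using (this.tendsto 0).mono_left nhdsWithin_le_nhds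
    obtain ⟨s, hs, hs0⟩ := ((hc.eventually_mem
      (mem_interior_iff_mem_nhds.1 hz)).and self_mem_nhdsWithin).exists
    have h1 := hu.2 _ hs
    have h2 := hν.2 z (interior_subset hz)
    have hs0' : 0 < s := hs0
    rw [hut] at h1
    simp only [one_smul, inner_neg_right, inner_sub_left, real_inner_smul_left,
      real_inner_self_eq_norm_sq, hν.1] at h1
    linarith
  · simpa using hut

theorem tendsto_normal (C : OsculatingChart S x ν) (hS : IsClosed S)
    (hint : (interior S).Nonempty) (hν : IsOuterNormalAt S x ν) {u : Euc (m + 1) → Euc (m + 1)}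
    (hu : ∀ z ∈ frontier S, IsOuterNormalAt S z (u z)) :
    Tendsto u (𝓝[frontier S] x) (𝓝 ν) := by
  refine (isCompact_sphere (0 : Euc (m + 1)) 1).tendsto_nhds_of_unique_mapClusterPt ?_ ?_
  · filter_upwards [self_mem_nhdsWithin] with z hz
    simpa using (hu z hz).1
  · intro u' hu' hcl
    obtain ⟨U, hU, hlim⟩ := mapClusterPt_iff_ultrafilter.1 hcl
    refine C.eq_normal hS hint hν ⟨by simpa using hu', fun y hy => ?_⟩
    have hid : Tendsto (fun z : Euc (m + 1) => z) U (𝓝 x) := hU.trans nhdsWithin_le_nhds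
    refine le_of_tendsto_of_tendsto (tendsto_const_nhds.inner hlim) (hid.inner hlim) ?_
    filter_upwards [hU self_mem_nhdsWithin] with z hz
    exact (hu z hz).2 y hy

end OsculatingChart

end OsculatingChart

section ExcessVolume

/-- The volume gained by passing from `S` to `conv (S ∪ {y})`. -/
def excessVolume {n : ℕ} (S : Set (Euc n)) (y : Euc n) : ℝ :=
  (volume (convexHull ℝ (S ∪ {y}))).toReal - (volume S).toReal

theorem volume_convexHull_union_singleton_lt_top {n : ℕ} {S : Set (Euc n)} (hS : IsCompact S)
    (y : Euc n) : volume (convexHull ℝ (S ∪ {y})) < ⊤ :=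
  (isBounded_convexHull.2 (hS.union isCompact_singleton).isBounded).measure_lt_top

theorem excessVolume_nonneg {n : ℕ} {S : Set (Euc n)} (hS : IsCompact S) (y : Euc n) :
    0 ≤ excessVolume S y :=
  sub_nonneg.2 <| ENNReal.toReal_mono (volume_convexHull_union_singleton_lt_top hS y).ne <|
    measure_mono <| subset_union_left.trans (subset_convexHull ℝ _)

theorem excessVolume_mono {n : ℕ} {S : Set (Euc n)} (hS : IsCompact S) {y z : Euc n}
    (hz : z ∈ convexHull ℝ (S ∪ {y})) : excessVolume S z ≤ excessVolume S y := by
  refine sub_le_sub_right (ENNReal.toReal_mono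
    (volume_convexHull_union_singleton_lt_top hS y).ne (measure_mono ?_)) _
  refine convexHull_min ?_ (convex_convexHull ℝ _)
  rintro w (hw | rfl)
  · exact subset_convexHull ℝ _ (Or.inl hw)
  · exact hz

theorem segment_subset_convexHull_union {n : ℕ} {S : Set (Euc n)} {z : Euc n} (hz : z ∈ S)
    (y : Euc n) : segment ℝ z y ⊆ convexHull ℝ (S ∪ {y}) :=
  segment_subset_convexHull (s := S ∪ {y}) (Or.inl hz) (Or.inr rfl)

/-- The leading order volume of the cap cut off at height `h`, where `a` is the square root of
the curvature of an `m`-dimensional hypersurface. -/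
def capVolume (m : ℕ) (a h : ℝ) : ℝ :=
  (2 * h) ^ (((m : ℝ) + 2) / 2) / (((m : ℝ) + 1) * ((m : ℝ) + 2)) *
    ((volume (ball (0 : Euc m) 1)).toReal / a)

theorem capVolume_eq_mul {m : ℕ} {h η R : ℝ} (a : ℝ) (hh : 0 < h) (hη : 0 < η) (hR : 0 < R)
    (hRh : (1 + η) * R ^ 2 = 2 * h) :
    capVolume m a h = R ^ m * h / a * (1 + η) ^ ((m : ℝ) / 2) *
      (2 / (((m : ℝ) + 1) * ((m : ℝ) + 2)) * (volume (ball (0 : Euc m) 1)).toReal) := by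
  have h1 : (2 * h) ^ (((m : ℝ) + 2) / 2) = R ^ m * (1 + η) ^ ((m : ℝ) / 2) * (2 * h) := by
    rw [show ((m : ℝ) + 2) / 2 = m / 2 + 1 by ring, Real.rpow_add_one (by positivity), ← hRh,
      Real.mul_rpow (by positivity) (by positivity), ← Real.rpow_natCast R 2, ← Real.rpow_mul hR.le]
    rw [show ((2 : ℕ) : ℝ) * ((m : ℝ) / 2) = m by push_cast; ring, Real.rpow_natCast]
    ring
  rw [capVolume, h1]
  ring

end ExcessVolume

namespace OsculatingChart

variable {m : ℕ} {S : Set (Euc (m + 1))} {x ν : Euc (m + 1)}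

theorem tangentPoint_sub (C : OsculatingChart S x ν) (v : Euc m) (h : ℝ) :
    tangentPoint x C.L ν (v, C.f v - h) = C.point v + h • ν := by
  simp only [point, tangentPoint, sub_smul]
  abel

theorem eventually_inner_pos (C : OsculatingChart S x ν) (hS : IsClosed S)
    (hint : (interior S).Nonempty) (hν : IsOuterNormalAt S x ν) {u : Euc (m + 1) → Euc (m + 1)}
    (hu : ∀ z ∈ frontier S, IsOuterNormalAt S z (u z)) :
    ∀ᶠ z in 𝓝[frontier S] x, 0 < ⟪ν, u z⟫ := by
  have h : Tendsto (fun z => ⟪ν, u z⟫) (𝓝[frontier S] x) (𝓝 ⟪ν, ν⟫) :=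
    tendsto_const_nhds.inner (C.tendsto_normal hS hint hν hu)
  refine h.eventually (lt_mem_nhds ?_)
  rw [real_inner_self_eq_norm_sq, hν.1]
  norm_num

theorem exists_not_mem (C : OsculatingChart S x ν) (hS : IsClosed S)
    (hint : (interior S).Nonempty) (hν : IsOuterNormalAt S x ν) {u : Euc (m + 1) → Euc (m + 1)}
    (hu : ∀ z ∈ frontier S, IsOuterNormalAt S z (u z)) :
    ∃ ρ > 0, ∀ v, ‖v‖ < ρ → ∀ t < C.f v, tangentPoint x C.L ν (v, t) ∉ S := by
  refine exists_ball_of_eventually ?_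
  filter_upwards [C.tendsto_point_frontier.eventually (C.eventually_inner_pos hS hint hν hu),
    C.eventually_point_mem_frontier] with v hpos hv t ht hmem
  have := (hu _ hv).2 _ hmem
  have hp : ⟪C.point v, u (C.point v)⟫ = _ := inner_tangentPoint x (v, C.f v) _
  rw [inner_tangentPoint, hp] at this
  simp only at this
  nlinarith

theorem norm_le_mul_norm_T (C : OsculatingChart S x ν) :
    ∃ K > 0, ∀ w, ‖w‖ ≤ K * ‖C.T w‖ := by
  refine ⟨‖(C.T.symm : Euc m →L[ℝ] Euc m)‖ + 1, by positivity, fun w => ?_⟩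
  calc ‖w‖ = ‖(C.T.symm : Euc m →L[ℝ] Euc m) (C.T w)‖ := by simp
    _ ≤ ‖(C.T.symm : Euc m →L[ℝ] Euc m)‖ * ‖C.T w‖ := ContinuousLinearMap.le_opNorm _ _
    _ ≤ _ := by gcongr; simp

theorem exists_le_excessVolume (C : OsculatingChart S x ν) (hm : m ≠ 0) (hS : IsCompact S)
    (hint : (interior S).Nonempty) (hν : IsOuterNormalAt S x ν) {u : Euc (m + 1) → Euc (m + 1)}
    (hu : ∀ z ∈ frontier S, IsOuterNormalAt S z (u z)) {ε : ℝ} (hε : 0 < ε) :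
    ∃ ρ > 0, ∃ h₁ > 0, ∀ v, ‖v‖ < ρ → ∀ h, 0 < h → h ≤ h₁ →
      (1 - ε) * capVolume m |(C.T : Euc m →L[ℝ] Euc m).det| h
        ≤ excessVolume S (C.point v + h • ν) := by
  have : Nonempty (Fin m) := ⟨⟨0, Nat.pos_of_ne_zero hm⟩⟩
  obtain ⟨η, hη, hηε⟩ : ∃ η > (0 : ℝ), (1 - ε) * (1 + η) ^ ((m : ℝ) / 2)
      ≤ 1 - (m + 1) * (m + 2) * η := by
    have hc : ContinuousAt (fun η : ℝ => 1 - ((m : ℝ) + 1) * (m + 2) * η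
        - (1 - ε) * (1 + η) ^ ((m : ℝ) / 2)) 0 := by
      have : ContinuousAt (fun η : ℝ => (1 + η) ^ ((m : ℝ) / 2)) 0 :=
        ContinuousAt.rpow_const (by fun_prop) (by norm_num)
      fun_prop
    have h0 := (hc.eventually_mem (isOpen_Ioi.mem_nhds (show _ ∈ Ioi (0 : ℝ) by simpa using hε)))
    obtain ⟨η, h1, h2⟩ := ((h0.filter_mono nhdsWithin_le_nhds).and
      (self_mem_nhdsWithin (s := Ioi (0 : ℝ)))).exists
    exact ⟨η, h2, by linarith [show (0 : ℝ) < _ from h1]⟩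
  obtain ⟨ρ₁, hρ₁, h₁⟩ := C.taylor (η / 2) (by positivity)
  obtain ⟨ρ₂, hρ₂, h₂⟩ := C.graph_mem
  obtain ⟨ρ₃, hρ₃, h₃⟩ := C.exists_not_mem hS.isClosed hint hν hu
  obtain ⟨K, hK, hKT⟩ := C.norm_le_mul_norm_T
  set ρ := min ρ₁ (min ρ₂ ρ₃) / 2
  have hρ : 0 < ρ := by positivity
  have hle₁ : 2 * ρ ≤ ρ₁ := by simp only [ρ]; linarith [min_le_left ρ₁ (min ρ₂ ρ₃)]
  have hle : 2 * ρ ≤ min ρ₂ ρ₃ := by simp only [ρ]; linarith [min_le_right ρ₁ (min ρ₂ ρ₃)]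
  have hle₂ : 2 * ρ ≤ ρ₂ := hle.trans (min_le_left _ _)
  have hle₃ : 2 * ρ ≤ ρ₃ := hle.trans (min_le_right _ _)
  refine ⟨ρ, hρ, (ρ / K) ^ 2 / 4, by positivity, fun v hv h hh hhle => ?_⟩
  set R := √(2 * h / (1 + η))
  have hR : 0 < R := by positivity
  have hRh : (1 + η) * R ^ 2 = 2 * h := by
    rw [Real.sq_sqrt (by positivity)]
    field_simp
  have hRρ : R < ρ / K := by
    refine lt_of_pow_lt_pow_left₀ 2 (by positivity) ?_
    have : 0 < (ρ / K) ^ 2 := by positivity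
    nlinarith [sq_nonneg R]
  have hw : ∀ w, ‖C.T w‖ ≤ R → ‖w‖ < ρ := by
    intro w hw
    refine (hKT w).trans_lt ?_
    rw [mul_comm]
    exact (lt_div_iff₀ hK).1 (hw.trans_lt hRρ)
  have hvw : ∀ w, ‖C.T w‖ ≤ R → ‖v + w‖ < 2 * ρ := fun w h =>
    (norm_add_le _ _).trans_lt (by linarith [hw w h])
  have key := le_volume_convexHull_sub (x := x) hS hν.1 C.inner_L (by simp) (f := C.f) (ℓ := C.ℓ v)
    (T := C.T) (v₀ := v) hh hη hR hRh
    (fun w h => h₁ v w (by linarith) (by linarith [hw w h]))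
    (fun w h => hS.isClosed.frontier_subset (h₂ _ ((hvw w h).trans_le hle₂)))
    (fun w h => h₃ _ ((hvw w h).trans_le hle₃))
  rw [C.tangentPoint_sub] at key
  refine le_trans ?_ key
  rw [capVolume_eq_mul _ hh hη hR hRh]
  simp only [finrank_euclideanSpace, Fintype.card_fin, Measure.real]
  set B := (volume (ball (0 : Euc m) 1)).toReal
  set q := R ^ m * h / |(C.T : Euc m →L[ℝ] Euc m).det|
  have hq : 0 ≤ q := by positivity
  have hB : 0 ≤ B := ENNReal.toReal_nonneg
  have hM : (0 : ℝ) < ((m : ℝ) + 1) * (m + 2) := by positivity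
  calc (1 - ε) * (q * (1 + η) ^ ((m : ℝ) / 2) * (2 / (((m : ℝ) + 1) * (m + 2)) * B))
      = q * B * (2 / (((m : ℝ) + 1) * (m + 2))) * ((1 - ε) * (1 + η) ^ ((m : ℝ) / 2)) := by ring
    _ ≤ q * B * (2 / (((m : ℝ) + 1) * (m + 2))) * (1 - (m + 1) * (m + 2) * η) := by gcongr
    _ = _ := by field_simp

end OsculatingChart

namespace OsculatingChart

variable {m : ℕ} {S : Set (Euc (m + 1))} {x ν : Euc (m + 1)}

theorem exists_eq_point_add_smul (C : OsculatingChart S x ν) (hν : ‖ν‖ = 1) (y : Euc (m + 1)) :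
    ∃ v h, y = C.point v + h • ν ∧ ‖v‖ ^ 2 + (C.f v - h) ^ 2 = ‖y - x‖ ^ 2 := by
  obtain ⟨⟨v, t⟩, rfl⟩ := tangentPoint_surjective x hν C.inner_L (by simp) y
  refine ⟨v, C.f v - t, ?_, ?_⟩
  · rw [← C.tangentPoint_sub, sub_sub_cancel]
  · rw [norm_tangentPoint_sub_sq x hν C.inner_L, sub_sub_cancel]

theorem exists_norm_sq_le_f (C : OsculatingChart S x ν) :
    ∃ c > 0, ∃ ρ > 0, ∀ v, ‖v‖ < ρ → c * ‖v‖ ^ 2 ≤ C.f v := by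
  obtain ⟨ρ, hρ, h⟩ := C.taylor (1 / 4) (by norm_num)
  obtain ⟨K, hK, hKT⟩ := C.norm_le_mul_norm_T
  refine ⟨1 / (4 * K ^ 2), by positivity, ρ, hρ, fun v hv => ?_⟩
  have h1 := (abs_le.1 (h 0 v (by simpa using hρ) hv)).1
  rw [zero_add, C.f_zero, C.ℓ_zero] at h1
  simp only [zero_apply] at h1
  have h2 : ‖v‖ ^ 2 ≤ K ^ 2 * ‖C.T v‖ ^ 2 := by
    rw [← mul_pow]
    gcongr
    exact hKT v
  calc 1 / (4 * K ^ 2) * ‖v‖ ^ 2 ≤ 1 / (4 * K ^ 2) * (K ^ 2 * ‖C.T v‖ ^ 2) := by gcongr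
    _ = ‖C.T v‖ ^ 2 / 4 := by field_simp
    _ ≤ C.f v := by linarith

theorem exists_le_height (C : OsculatingChart S x ν) (hS : IsClosed S)
    (hint : (interior S).Nonempty) (hν : IsOuterNormalAt S x ν) {u : Euc (m + 1) → Euc (m + 1)}
    (hu : ∀ z ∈ frontier S, IsOuterNormalAt S z (u z)) :
    ∃ ρ > 0, ∀ r, 0 < r → r < ρ → ∃ h₀ > 0, ∀ᶠ z in 𝓝[frontier S] x, ∀ v h,
      ‖v‖ ^ 2 + (C.f v - h) ^ 2 = r ^ 2 → ⟪z, u z⟫ ≤ ⟪C.point v + h • ν, u z⟫ → h₀ ≤ h := by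
  obtain ⟨c, hc, ρ, hρ, hf⟩ := C.exists_norm_sq_le_f
  refine ⟨ρ, hρ, fun r hr hrρ => ?_⟩
  set γ := min (c * r ^ 2 / 8) (r / 4)
  have hγ : 0 < γ := by positivity
  have hγ1 : γ ≤ c * r ^ 2 / 8 := min_le_left _ _
  have hγ2 : γ ≤ r / 4 := min_le_right _ _
  refine ⟨γ, hγ, ?_⟩
  have hlim : Tendsto (fun z => 2 * r * ‖u z - ν‖ + 3 * ‖z - x‖) (𝓝[frontier S] x) (𝓝 0) := by
    have h1 := (tendsto_iff_norm_sub_tendsto_zero.1 (C.tendsto_normal hS hint hν hu)).const_mul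
      (2 * r)
    have h2 : Tendsto (fun z : Euc (m + 1) => 3 * ‖z - x‖) (𝓝[frontier S] x) (𝓝 0) := by
      have : Continuous fun z : Euc (m + 1) => 3 * ‖z - x‖ := by fun_prop
      simpa using (this.tendsto x).mono_left nhdsWithin_le_nhds
    simpa using h1.add h2
  filter_upwards [hlim.eventually (gt_mem_nhds hγ), self_mem_nhdsWithin] with z hz hzS v h hvh hle
  set y := C.point v + h • ν
  have hy : y = tangentPoint x C.L ν (v, C.f v - h) := (C.tangentPoint_sub v h).symm
  have hyx : ‖y - x‖ = r := by
    have := norm_tangentPoint_sub_sq x hν.1 C.inner_L (v, C.f v - h)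
    rw [← hy] at this
    simp only [hvh] at this
    exact (pow_left_inj₀ (norm_nonneg _) hr.le two_ne_zero).1 this
  have hyν : ⟪y - x, ν⟫ = h - C.f v := by
    rw [inner_sub_left, hy, inner_tangentPoint, C.inner_L, real_inner_self_eq_norm_sq, hν.1]
    ring
  have hlow : -γ ≤ h - C.f v := by
    have e : ⟪y - x, ν⟫ = ⟪y - z, u z⟫ + ⟪z - x, u z⟫ - ⟪y - x, u z - ν⟫ := by
      simp only [inner_sub_left, inner_sub_right]
      ring
    have h1 : 0 ≤ ⟪y - z, u z⟫ := by rw [inner_sub_left]; linarith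
    have h2 := abs_le.1 ((abs_real_inner_le_norm (z - x) (u z)))
    have h3 := abs_le.1 ((abs_real_inner_le_norm (y - x) (u z - ν)))
    rw [(hu z hzS).1, mul_one] at h2
    rw [hyx] at h3
    have h4 : 0 ≤ r * ‖u z - ν‖ := by positivity
    have h5 := norm_nonneg (z - x)
    linarith
  have hvr : ‖v‖ ≤ r := by
    refine le_of_sq_le_sq ?_ hr.le
    nlinarith [sq_nonneg (C.f v - h)]
  have hfv := hf v (hvr.trans_lt hrρ)
  rcases le_or_gt (r / 2) ‖v‖ with hv | hv
  · have : c * (r / 2) ^ 2 ≤ c * ‖v‖ ^ 2 := by gcongr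
    linarith
  · have hf0 : 0 ≤ C.f v := le_trans (by positivity) hfv
    by_contra! hlt
    have h1 : -(r / 4) ≤ h - C.f v := by linarith
    have h2 : h - C.f v < r / 4 := by linarith
    have h3 : (C.f v - h) ^ 2 ≤ (r / 4) ^ 2 := sq_le_sq' (by linarith) (by linarith)
    have h4 : ‖v‖ ^ 2 ≤ (r / 2) ^ 2 := by gcongr
    nlinarith [pow_pos hr 2]

theorem point_add_smul_mem_convexHull (C : OsculatingChart S x ν) {v : Euc m} {h h' : ℝ}
    (hv : C.point v ∈ S) (h0 : 0 ≤ h') (hle : h' ≤ h) :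
    C.point v + h' • ν ∈ convexHull ℝ (S ∪ {C.point v + h • ν}) := by
  rcases h0.eq_or_lt with rfl | hpos
  · simpa using segment_subset_convexHull_union hv _ (left_mem_segment ℝ _ (C.point v + h • ν))
  · have hh : 0 < h := hpos.trans_le hle
    refine segment_subset_convexHull_union hv _ ?_
    rw [segment_eq_image']
    refine ⟨h' / h, ⟨by positivity, (div_le_one hh).2 hle⟩, ?_⟩
    simp [smul_smul, hh.ne']

theorem eventually_capVolume_le (C : OsculatingChart S x ν) (hm : m ≠ 0) (hS : IsCompact S)
    (hint : (interior S).Nonempty) (hν : IsOuterNormalAt S x ν) {u : Euc (m + 1) → Euc (m + 1)}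
    (hu : ∀ z ∈ frontier S, IsOuterNormalAt S z (u z)) {ε : ℝ} (hε : 0 < ε) (hε1 : ε < 1) :
    ∃ δ > 0, ∀ᶠ z in 𝓝[frontier S] x, ∀ Δ, 0 < Δ → Δ ≤ δ → ∀ y, ⟪z, u z⟫ + Δ ≤ ⟪y, u z⟫ →
      (1 - ε) * capVolume m |(C.T : Euc m →L[ℝ] Euc m).det| Δ ≤ excessVolume S y := by
  obtain ⟨ρ₁, hρ₁, h₁, hh₁, hexc⟩ := C.exists_le_excessVolume hm hS hint hν hu hε
  obtain ⟨ρ₂, hρ₂, hheight⟩ := C.exists_le_height hS.isClosed hint hν hu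
  obtain ⟨ρ₃, hρ₃, hgraph⟩ := C.graph_mem
  set r := min ρ₁ (min ρ₂ ρ₃) / 2
  have hr : 0 < r := by positivity
  have hr₁ : r < ρ₁ := (half_lt_self (by positivity)).trans_le (min_le_left _ _)
  have hr' : r < min ρ₂ ρ₃ := (half_lt_self (by positivity)).trans_le (min_le_right _ _)
  have hr₂ : r < ρ₂ := hr'.trans_le (min_le_left _ _)
  have hr₃ : r < ρ₃ := hr'.trans_le (min_le_right _ _)
  obtain ⟨h₀, hh₀, hev⟩ := hheight r hr hr₂
  have hball : ∀ᶠ z in 𝓝[frontier S] x, ‖z - x‖ < r :=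
    eventually_nhdsWithin_of_eventually_nhds (eventually_norm_sub_lt x hr)
  refine ⟨min h₀ h₁, lt_min hh₀ hh₁, ?_⟩
  filter_upwards [hev, hball, C.eventually_inner_pos hS.isClosed hint hν hu, self_mem_nhdsWithin]
    with z hz hzr hpos hzS Δ hΔ hΔle y hy
  have hΔ₀ : Δ ≤ h₀ := hΔle.trans (min_le_left _ _)
  have hΔ₁ : Δ ≤ h₁ := hΔle.trans (min_le_right _ _)
  have hbound : ∀ v h, ‖v‖ ≤ r → Δ ≤ h → (1 - ε) * capVolume m |(C.T : Euc m →L[ℝ] Euc m).det| Δ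
      ≤ excessVolume S (C.point v + h • ν) := fun v h hv hh =>
    (hexc v (hv.trans_lt hr₁) Δ hΔ hΔ₁).trans <| excessVolume_mono hS <|
      C.point_add_smul_mem_convexHull (hS.isClosed.frontier_subset (hgraph v (hv.trans_lt hr₃)))
        hΔ.le hh
  have hnorm : ∀ {v : Euc m} {h s : ℝ}, ‖v‖ ^ 2 + (C.f v - h) ^ 2 = s ^ 2 → 0 ≤ s → s ≤ r →
      ‖v‖ ≤ r := fun {v h s} he hs hsr =>
    (le_of_sq_le_sq (by nlinarith [sq_nonneg (C.f v - h)]) hs).trans hsr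
  rcases le_or_gt ‖y - x‖ r with hyr | hyr
  · obtain ⟨v, h, rfl, hvh⟩ := C.exists_eq_point_add_smul hν.1 y
    have hv := hnorm hvh (norm_nonneg _) hyr
    refine hbound v h hv ?_
    have h1 := (hu z hzS).2 _ (hS.isClosed.frontier_subset (hgraph v (hv.trans_lt hr₃)))
    have h2 : ⟪ν, u z⟫ ≤ 1 := by
      simpa [hν.1, (hu z hzS).1] using real_inner_le_norm ν (u z)
    change ⟪C.point v, u z⟫ ≤ _ at h1
    rw [inner_add_left, real_inner_smul_left] at hy
    have h3 : 0 < h := pos_of_mul_pos_left (by linarith : 0 < h * ⟪ν, u z⟫) hpos.le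
    nlinarith
  · obtain ⟨s, hs, hsr⟩ : ∃ s ∈ Icc (0 : ℝ) 1, ‖z + s • (y - z) - x‖ = r := by
      have hc : ContinuousOn (fun s : ℝ => ‖z + s • (y - z) - x‖) (Icc 0 1) := by fun_prop
      exact intermediate_value_Icc zero_le_one hc
        ⟨by simpa using hzr.le, by simpa using hyr.le⟩
    have hmem : z + s • (y - z) ∈ convexHull ℝ (S ∪ {y}) := by
      refine segment_subset_convexHull_union (hS.isClosed.frontier_subset hzS) _ ?_
      rw [segment_eq_image']
      exact ⟨s, hs, rfl⟩
    refine le_trans ?_ (excessVolume_mono hS hmem)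
    have hle : ⟪z, u z⟫ ≤ ⟪z + s • (y - z), u z⟫ := by
      rw [inner_add_left, real_inner_smul_left, inner_sub_left]
      nlinarith [hs.1]
    obtain ⟨v, h, he, hvh⟩ := C.exists_eq_point_add_smul hν.1 (z + s • (y - z))
    rw [he] at hle ⊢
    rw [hsr] at hvh
    exact hbound v h (hnorm hvh hr.le le_rfl) (hΔ₀.trans (hz v h hvh hle))

end OsculatingChart

section Semicontinuity

theorem abs_det_le_of_norm_le {m : ℕ} {A B : Euc m →ₗ[ℝ] Euc m} (hB : LinearMap.det B ≠ 0)
    (h : ∀ w, ‖A w‖ ≤ ‖B w‖) : |LinearMap.det A| ≤ |LinearMap.det B| := by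
  rcases eq_or_ne (LinearMap.det A) 0 with hA | hA
  · simp [hA]
  have hsub : B ⁻¹' ball 0 1 ⊆ A ⁻¹' ball 0 1 := by
    intro w hw
    rw [mem_preimage, mem_ball_zero_iff] at hw ⊢
    exact (h w).trans_lt hw
  have hvol := measure_mono (μ := volume) hsub
  rw [Measure.addHaar_preimage_linearMap _ hB, Measure.addHaar_preimage_linearMap _ hA,
    ENNReal.mul_le_mul_iff_left (measure_ball_pos volume _ one_pos).ne' measure_ball_lt_top.ne,
    ENNReal.ofReal_le_ofReal_iff (abs_nonneg _), abs_inv, abs_inv] at hvol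
  exact (inv_le_inv₀ (abs_pos.2 hB) (abs_pos.2 hA)).1 hvol

theorem pow_mul_abs_det_le {m : ℕ} {A B : Euc m →ₗ[ℝ] Euc m} (hB : LinearMap.det B ≠ 0)
    {θ : ℝ} (hθ : 0 ≤ θ) (h : ∀ w, θ ^ 2 * ‖A w‖ ^ 2 ≤ ‖B w‖ ^ 2) :
    θ ^ m * |LinearMap.det A| ≤ |LinearMap.det B| := by
  have := abs_det_le_of_norm_le (A := θ • A) hB fun w => by
    refine le_of_sq_le_sq ?_ (norm_nonneg _)
    rw [LinearMap.smul_apply, norm_smul, mul_pow, Real.norm_of_nonneg hθ]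
    exact h w
  rwa [LinearMap.det_smul, abs_mul, abs_pow, abs_of_nonneg hθ, finrank_euclideanSpace,
    Fintype.card_fin] at this

end Semicontinuity

namespace OsculatingChart

variable {m : ℕ} {S : Set (Euc (m + 1))} {x ν : Euc (m + 1)}

/-- The coordinate, along the tangent hyperplane at `x`, of a vector of the ambient space. -/
def tangential (C : OsculatingChart S x ν) : Euc (m + 1) →L[ℝ] Euc m :=
  ContinuousLinearMap.adjoint C.L.toContinuousLinearMap

theorem tangential_L (C : OsculatingChart S x ν) (v : Euc m) : C.tangential (C.L v) = v := by
  refine ext_inner_right ℝ fun w => ?_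
  rw [tangential, ContinuousLinearMap.adjoint_inner_left]
  exact C.L.inner_map_map v w

theorem tangential_normal (C : OsculatingChart S x ν) : C.tangential ν = 0 := by
  refine ext_inner_right ℝ fun w => ?_
  rw [tangential, ContinuousLinearMap.adjoint_inner_left, inner_zero_left, real_inner_comm]
  exact C.inner_L w

theorem norm_tangential_sq (C : OsculatingChart S x ν) (hν : ‖ν‖ = 1) (a : Euc (m + 1)) :
    ‖C.tangential a‖ ^ 2 = ‖a‖ ^ 2 - ⟪a, ν⟫ ^ 2 := by
  obtain ⟨⟨v, t⟩, rfl⟩ := tangentPoint_surjective 0 hν C.inner_L (by simp) a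
  have h1 := norm_tangentPoint_sub_sq 0 hν C.inner_L (v, t)
  rw [sub_zero] at h1
  rw [h1, inner_tangentPoint, C.inner_L, real_inner_self_eq_norm_sq, hν]
  simp [tangentPoint, C.tangential_L, C.tangential_normal]

theorem norm_T_tangential_le (C : OsculatingChart S x ν) {z μ : Euc (m + 1)}
    (C' : OsculatingChart S z μ) {v : Euc m} {η ρ : ℝ} (hη : 0 < η) (hρ : 0 < ρ)
    (hμ : ‖μ‖ = 1) (hc : 0 ≤ ⟪ν, μ⟫) (hv : C.point v = z)
    (hL : ∀ w, ⟪C.L w, μ⟫ = C.ℓ v w * ⟪ν, μ⟫)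
    (htaylor : ∀ w, ‖w‖ < ρ → |C.f (v + w) - C.f v - C.ℓ v w - ‖C.T w‖ ^ 2 / 2|
      ≤ η * ‖C.T w‖ ^ 2)
    (hcoord : ∀ᶠ q in 𝓝[frontier S] z, ∃ v', C.point v' = q) (w : Euc m) :
    ⟪ν, μ⟫ * (1 / 2 - η) * ‖C.T (C.tangential (C'.L w))‖ ^ 2 ≤ (1 / 2 + η) * ‖C'.T w‖ ^ 2 := by
  set P := C.tangential (C'.L w)
  set Q := C.tangential μ
  have hline : Tendsto (fun t : ℝ => t • w) (𝓝[>] 0) (𝓝 0) := by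
    have : Continuous fun t : ℝ => t • w := by fun_prop
    simpa using (this.tendsto 0).mono_left nhdsWithin_le_nhds
  have hf' : ∀ᶠ t : ℝ in 𝓝[>] 0, |C'.f (t • w)| ≤ t ^ 2 * ((1 / 2 + η) * ‖C'.T w‖ ^ 2) := by
    obtain ⟨ρ', hρ', h⟩ := C'.taylor η hη
    filter_upwards [hline.eventually (eventually_norm_sub_lt 0 hρ')] with t ht
    have h1 := h 0 (t • w) (by simpa using hρ') (by simpa using ht)
    rw [zero_add, C'.f_zero, C'.ℓ_zero, C'.T.map_smul, norm_smul, mul_pow, Real.norm_eq_abs,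
      sq_abs] at h1
    simp only [zero_apply, sub_zero] at h1
    have h2 : 0 ≤ t ^ 2 * ‖C'.T w‖ ^ 2 := by positivity
    have h3 := abs_le.1 h1
    rw [abs_le]
    constructor <;> nlinarith
  have hquot : Tendsto (fun t : ℝ => C'.f (t • w) / t) (𝓝[>] 0) (𝓝 0) := by
    have hlin : Tendsto (fun t : ℝ => t * ((1 / 2 + η) * ‖C'.T w‖ ^ 2)) (𝓝[>] 0) (𝓝 0) := by
      have : Continuous fun t : ℝ => t * ((1 / 2 + η) * ‖C'.T w‖ ^ 2) := by fun_prop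
      simpa using (this.tendsto 0).mono_left nhdsWithin_le_nhds
    refine squeeze_zero_norm' ?_ hlin
    filter_upwards [hf', self_mem_nhdsWithin] with t ht h0
    have h0' : 0 < t := h0
    rw [norm_div, Real.norm_eq_abs, Real.norm_of_nonneg h0'.le, div_le_iff₀ h0']
    linarith
  have hlim : Tendsto (fun t : ℝ => P - (C'.f (t • w) / t) • Q) (𝓝[>] 0) (𝓝 P) := by
    simpa using tendsto_const_nhds.sub (hquot.smul_const Q)
  have hb : Tendsto (fun t : ℝ => t • (P - (C'.f (t • w) / t) • Q)) (𝓝[>] 0) (𝓝 0) := by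
    simpa using (tendsto_id.mono_left (nhdsWithin_le_nhds (s := Ioi (0 : ℝ)))).smul hlim
  have hlhs := (((C.T.continuous.tendsto P).comp hlim).norm.pow 2).const_mul
    (⟪ν, μ⟫ * (1 / 2 - η))
  refine le_of_tendsto hlhs ?_
  filter_upwards [hf', self_mem_nhdsWithin, hb.eventually (eventually_norm_sub_lt 0 hρ),
    hline.eventually (C'.tendsto_point_frontier.eventually hcoord)] with t ht h0 hbt hex
  obtain ⟨v', hv'⟩ := hex
  have h0' : 0 < t := h0
  set b := t • (P - (C'.f (t • w) / t) • Q)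
  have hdiff : C.point v' - C.point v = C'.L (t • w) - C'.f (t • w) • μ := by
    rw [hv', hv, point, tangentPoint]
    abel
  have hdiff' : C.point v' - C.point v = C.L (v' - v) - (C.f v' - C.f v) • ν := by
    simp only [point, tangentPoint, map_sub, sub_smul]
    abel
  have hvb : v' = v + b := by
    have e := congrArg C.tangential (hdiff'.symm.trans hdiff)
    simp only [map_sub, map_smul, C.tangential_L, C.tangential_normal, smul_zero, sub_zero] at e
    rw [← sub_eq_iff_eq_add', e]
    simp only [b, P, Q, smul_sub, smul_smul, mul_div_cancel₀ _ h0'.ne']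
  have hinner := congrArg (fun a => ⟪a, μ⟫) (hdiff'.symm.trans hdiff)
  simp only [inner_sub_left, real_inner_smul_left, C'.inner_L, real_inner_self_eq_norm_sq, hμ, hL]
    at hinner
  rw [hvb, add_sub_cancel_left] at hinner
  have htay := (abs_le.1 (htaylor b (by simpa using hbt))).1
  have hTb : ‖C.T b‖ ^ 2 = t ^ 2 * ‖C.T (P - (C'.f (t • w) / t) • Q)‖ ^ 2 := by
    rw [C.T.map_smul, norm_smul, mul_pow, Real.norm_eq_abs, sq_abs]
  have hmul := mul_le_mul_of_nonneg_left htay hc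
  have hup := (abs_le.1 ht).2
  refine le_of_mul_le_mul_left ?_ (pow_pos h0' 2)
  simp only [Function.comp_apply]
  rw [hTb] at hmul
  linarith

theorem eventually_abs_det_le (C : OsculatingChart S x ν) (hS : IsClosed S)
    (hint : (interior S).Nonempty) (hν : IsOuterNormalAt S x ν) {u : Euc (m + 1) → Euc (m + 1)}
    (hu : ∀ z ∈ frontier S, IsOuterNormalAt S z (u z)) {ε : ℝ} (hε : 0 < ε) :
    ∀ᶠ z in 𝓝[frontier S] x, ∀ C' : OsculatingChart S z (u z),
      (1 - ε) * |(C.T : Euc m →L[ℝ] Euc m).det| ≤ |(C'.T : Euc m →L[ℝ] Euc m).det| := by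
  obtain ⟨θ, hθ0, hθ1, hθε⟩ : ∃ θ : ℝ, 0 < θ ∧ θ < 1 ∧ 1 - ε ≤ θ ^ m * θ ^ m := by
    have hc : ContinuousAt (fun θ : ℝ => θ ^ m * θ ^ m) 1 := by fun_prop
    have h1 : ∀ᶠ θ : ℝ in 𝓝[<] 1, 1 - ε < θ ^ m * θ ^ m :=
      (hc.eventually (lt_mem_nhds (by simpa using hε))).filter_mono nhdsWithin_le_nhds
    obtain ⟨θ, h2, h3⟩ := (h1.and (Ioo_mem_nhdsLT (zero_lt_one (α := ℝ)))).exists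
    exact ⟨θ, h3.1, h3.2, h2.le⟩
  have hθ2 : θ ^ 2 < 1 := by nlinarith
  set η := (1 - θ ^ 2) / 8
  have hη : 0 < η := by simp only [η]; linarith
  have hη1 : θ ^ 2 * (1 / 2 + η) < 1 * (1 / 2 - η) := by simp only [η]; nlinarith
  obtain ⟨ρ₁, hρ₁, htaylor⟩ := C.taylor η hη
  obtain ⟨ρ₂, hρ₂, hcoord⟩ := C.exists_coord
  obtain ⟨ρ₃, hρ₃, hinner⟩ := C.exists_inner_L_eq hS
  have hlim := C.tendsto_normal hS hint hν hu
  have hcos : ∀ᶠ z in 𝓝[frontier S] x, θ ^ 2 * (1 / 2 + η) < ⟪ν, u z⟫ * (1 / 2 - η) := by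
    have h1 : Tendsto (fun z => ⟪ν, u z⟫ * (1 / 2 - η)) (𝓝[frontier S] x)
        (𝓝 (1 * (1 / 2 - η))) := by
      have := (tendsto_const_nhds.inner hlim (x := ν)).mul_const (1 / 2 - η)
      rwa [real_inner_self_eq_norm_sq, hν.1, one_pow] at this
    exact h1.eventually (lt_mem_nhds hη1)
  have hsin : ∀ᶠ z in 𝓝[frontier S] x, ‖u z - ν‖ ^ 2 < 1 - θ ^ 2 := by
    have h1 := (tendsto_iff_norm_sub_tendsto_zero.1 hlim).pow 2
    exact h1.eventually (gt_mem_nhds (by simpa using hθ2))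
  have hball : ∀ {r : ℝ}, 0 < r → ∀ᶠ z in 𝓝[frontier S] x, ‖z - x‖ < r := fun hr =>
    eventually_nhdsWithin_of_eventually_nhds (eventually_norm_sub_lt x hr)
  filter_upwards [hcos, hsin, C.eventually_inner_pos hS hint hν hu, hball hρ₁, hball hρ₂,
    hball hρ₃, self_mem_nhdsWithin] with z hcz hsz hpos hz₁ hz₂ hz₃ hzS C'
  obtain ⟨v, hvz, hv⟩ := hcoord z hzS hz₂
  have hcoord' : ∀ᶠ q in 𝓝[frontier S] z, ∃ v', C.point v' = q := by
    have : ∀ᶠ q in 𝓝[frontier S] z, ‖q - x‖ < ρ₂ := eventually_nhdsWithin_of_eventually_nhds <|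
      (by fun_prop : Continuous fun q => ‖q - x‖).continuousAt.eventually_lt_const hz₂
    filter_upwards [this, self_mem_nhdsWithin] with q hq hqS
    obtain ⟨v', -, h⟩ := hcoord q hqS hq
    exact ⟨v', h.symm⟩
  have hkey := C.norm_T_tangential_le C' hη hρ₁ (hu z hzS).1 hpos.le hv.symm
    (hinner v (hvz.trans_lt hz₃) _ (by rw [point, ← hv]; exact hu z hzS))
    (fun w hw => htaylor v w (hvz.trans_lt hz₁) hw) hcoord'
  let P : Euc m →ₗ[ℝ] Euc m := C.tangential.toLinearMap ∘ₗ C'.L.toLinearMap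
  have hPnorm : ∀ w, θ ^ 2 * ‖w‖ ^ 2 ≤ ‖P w‖ ^ 2 := by
    intro w
    change _ ≤ ‖C.tangential (C'.L w)‖ ^ 2
    rw [C.norm_tangential_sq hν.1, C'.L.norm_map]
    have e : ⟪C'.L w, ν⟫ = -⟪C'.L w, u z - ν⟫ := by
      rw [inner_sub_right, C'.inner_L]
      ring
    have h1 : ⟪C'.L w, u z - ν⟫ ^ 2 ≤ (‖w‖ * ‖u z - ν‖) ^ 2 := by
      rw [← sq_abs]
      gcongr
      simpa using abs_real_inner_le_norm (C'.L w) (u z - ν)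
    rw [e, neg_sq]
    nlinarith [sq_nonneg ‖w‖]
  have hPdet : LinearMap.det P ≠ 0 := by
    refine mt LinearMap.det_eq_zero_iff_ker_ne_bot.1
      (not_not.2 (LinearMap.ker_eq_bot'.2 fun w hw => ?_))
    have h1 := hPnorm w
    rw [hw, norm_zero, zero_pow two_ne_zero] at h1
    have h2 : ‖w‖ ^ 2 ≤ 0 := nonpos_of_mul_nonpos_right h1 (pow_pos hθ0 2)
    simpa using le_antisymm h2 (sq_nonneg _)
  have hdet₁ : θ ^ m ≤ |LinearMap.det P| := by
    simpa using pow_mul_abs_det_le (A := LinearMap.id) hPdet hθ0.le (by simpa using hPnorm)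
  have hdet₂ : θ ^ m * |LinearMap.det (C.T.toLinearMap ∘ₗ P)| ≤ |LinearMap.det C'.T.toLinearMap| := by
    refine pow_mul_abs_det_le ?_ hθ0.le fun w => ?_
    · exact (LinearEquiv.isUnit_det' C'.T.toLinearEquiv).ne_zero
    · have h1 := hkey w
      change θ ^ 2 * ‖C.T (C.tangential (C'.L w))‖ ^ 2 ≤ ‖C'.T w‖ ^ 2
      set a := ‖C.T (C.tangential (C'.L w))‖ ^ 2
      have ha : 0 ≤ a := by positivity
      have h2 : θ ^ 2 * (1 / 2 + η) * a ≤ ⟪ν, u z⟫ * (1 / 2 - η) * a := by gcongr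
      have h3 : 0 < 1 / 2 + η := by positivity
      nlinarith
  rw [LinearMap.det_comp, abs_mul] at hdet₂
  change (1 - ε) * |LinearMap.det C.T.toLinearMap| ≤ |LinearMap.det C'.T.toLinearMap|
  calc (1 - ε) * |LinearMap.det C.T.toLinearMap|
      ≤ θ ^ m * θ ^ m * |LinearMap.det C.T.toLinearMap| := by gcongr
    _ ≤ θ ^ m * |LinearMap.det P| * |LinearMap.det C.T.toLinearMap| := by gcongr
    _ = θ ^ m * (|LinearMap.det C.T.toLinearMap| * |LinearMap.det P|) := by ring
    _ ≤ _ := hdet₂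

end OsculatingChart

theorem exists_uniform_capVolume_le {m : ℕ} (hm : m ≠ 0) {S : Set (Euc (m + 1))}
    {u : Euc (m + 1) → Euc (m + 1)} {κ : Euc (m + 1) → ℝ} (hS : IsCompact S)
    (hint : (interior S).Nonempty) (hC2 : IsC2Body S u κ) (hκ : ∀ x ∈ frontier S, 0 < κ x)
    {ε : ℝ} (hε : 0 < ε) (hε1 : ε < 1) :
    ∃ δ > 0, ∀ x ∈ frontier S, ∀ Δ, 0 < Δ → Δ ≤ δ → ∀ y, ⟪x, u x⟫ + Δ ≤ ⟪y, u x⟫ →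
      capVolume m (κ x ^ ((1 : ℝ) / 2)) Δ * (1 - ε) ≤ excessVolume S y := by
  have hu : ∀ z ∈ frontier S, IsOuterNormalAt S z (u z) := fun z hz => (hC2 z hz).1
  have hchart : ∀ z ∈ frontier S, ∃ C : OsculatingChart S z (u z),
      |(C.T : Euc m →L[ℝ] Euc m).det| = κ z ^ ((1 : ℝ) / 2) := by
    intro z hz
    obtain ⟨C, hC⟩ := exists_osculatingChart hS.isClosed (hu z hz) (hC2 z hz).2 (hκ z hz)
    exact ⟨C, by rw [← hC, ← Real.sqrt_eq_rpow, Real.sqrt_sq_eq_abs]⟩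
  have hfr : IsCompact (frontier S) := hS.of_isClosed_subset isClosed_frontier
    hS.isClosed.frontier_subset
  refine hfr.induction_on (p := fun s => ∃ δ > 0, ∀ x ∈ s, ∀ Δ, 0 < Δ → Δ ≤ δ → ∀ y,
    ⟪x, u x⟫ + Δ ≤ ⟪y, u x⟫ →
      capVolume m (κ x ^ ((1 : ℝ) / 2)) Δ * (1 - ε) ≤ excessVolume S y) ?_ ?_ ?_ ?_
  · exact ⟨1, one_pos, by simp⟩
  · rintro s t hst ⟨δ, hδ, h⟩
    exact ⟨δ, hδ, fun x hx => h x (hst hx)⟩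
  · rintro s t ⟨δ₁, hδ₁, h₁⟩ ⟨δ₂, hδ₂, h₂⟩
    refine ⟨min δ₁ δ₂, lt_min hδ₁ hδ₂, ?_⟩
    rintro x (hx | hx) Δ h0 hΔ
    · exact h₁ x hx Δ h0 (hΔ.trans (min_le_left _ _))
    · exact h₂ x hx Δ h0 (hΔ.trans (min_le_right _ _))
  · intro x hx
    obtain ⟨C, -⟩ := hchart x hx
    have hε2 : 0 < ε / 2 := by positivity
    obtain ⟨δ, hδ, hcap⟩ := C.eventually_capVolume_le hm hS hint (hu x hx) hu hε2 (by linarith)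
    refine ⟨_, hcap.and ((C.eventually_abs_det_le hS.isClosed hint (hu x hx) hu hε2).and
      (self_mem_nhdsWithin (s := frontier S))), δ, hδ, ?_⟩
    rintro z ⟨hz, hdet, hzS⟩ Δ h0 hΔ y hy
    refine le_trans ?_ (hz Δ h0 hΔ y hy)
    obtain ⟨C', hC'⟩ := hchart z hzS
    have hle := hdet C'
    rw [hC'] at hle
    have ha : 0 < |(C.T : Euc m →L[ℝ] Euc m).det| :=
      abs_pos.2 (LinearEquiv.isUnit_det' C.T.toLinearEquiv).ne_zero
    set a := |(C.T : Euc m →L[ℝ] Euc m).det|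
    have hε3 : 0 < 1 - ε / 2 := by linarith
    unfold capVolume
    set B := (volume (ball (0 : Euc m) 1)).toReal
    have hB : 0 ≤ B := ENNReal.toReal_nonneg
    have h1 : B / κ z ^ ((1 : ℝ) / 2) ≤ B / ((1 - ε / 2) * a) := by gcongr
    set q := (2 * Δ) ^ (((m : ℝ) + 2) / 2) / (((m : ℝ) + 1) * ((m : ℝ) + 2))
    have hq : 0 ≤ q := by positivity
    calc q * (B / κ z ^ ((1 : ℝ) / 2)) * (1 - ε)
        ≤ q * (B / ((1 - ε / 2) * a)) * (1 - ε / 2) ^ 2 := by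
          have : 0 ≤ B / ((1 - ε / 2) * a) := by positivity
          refine mul_le_mul (by gcongr) (by nlinarith) (by linarith) (by positivity)
      _ = (1 - ε / 2) * (q * (B / a)) := by field_simp

theorem exists_tendsto_zero_of_forall_pos {P : ℝ → ℝ → Prop}
    (hclosed : ∀ Δ, IsClosed {ε | P ε Δ}) (hone : ∀ Δ > 0, P 1 Δ)
    (hsmall : ∀ ε, 0 < ε → ε < 1 → ∃ δ > 0, ∀ Δ, 0 < Δ → Δ ≤ δ → P ε Δ) :
    ∃ ψ : ℝ → ℝ, (∀ Δ, 0 ≤ ψ Δ) ∧ Tendsto ψ (𝓝[>] 0) (𝓝 0) ∧ ∀ Δ > 0, P (ψ Δ) Δ := by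
  let A : ℝ → Set ℝ := fun Δ => Icc 0 1 ∩ {ε | P ε Δ}
  have hbdd : ∀ Δ, BddBelow (A Δ) := fun Δ => ⟨0, fun ε hε => hε.1.1⟩
  have hnonneg : ∀ Δ, 0 ≤ sInf (A Δ) := fun Δ => Real.sInf_nonneg fun ε hε => hε.1.1
  refine ⟨fun Δ => sInf (A Δ), hnonneg, ?_, fun Δ hΔ => ?_⟩
  · rw [tendsto_order]
    refine ⟨fun a ha => Eventually.of_forall fun Δ => ha.trans_le (hnonneg Δ), fun a ha => ?_⟩
    obtain ⟨δ, hδ, h⟩ := hsmall (min (a / 2) (1 / 2)) (by positivity)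
      ((min_le_right _ _).trans_lt (by norm_num))
    filter_upwards [Ioc_mem_nhdsGT hδ] with Δ hΔ
    calc sInf (A Δ) ≤ min (a / 2) (1 / 2) :=
          csInf_le (hbdd Δ) ⟨⟨by positivity, (min_le_right _ _).trans (by norm_num)⟩,
            h Δ hΔ.1 hΔ.2⟩
      _ ≤ a / 2 := min_le_left _ _
      _ < a := by linarith
  · exact ((isClosed_Icc.inter (hclosed Δ)).csInf_mem
      ⟨1, ⟨zero_le_one, le_rfl⟩, hone Δ hΔ⟩ (hbdd Δ)).2

/-- Lemma 2.10 (2): for `S` of class `C²₊` there is a nonnegative function `ψ` with `ψ(Δ) → 0`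
such that for every `x ∈ ∂S`, all small `Δ > 0` and every `y` with
`⟨y, u(x)⟩ ≥ ⟨x, u(x)⟩ + Δ`,
`((2Δ)^{(n+1)/2}/(n(n+1)))·|B₂^{n−1}|/κ(x)^{1/2}·(1 − ψ(Δ)) ≤ |conv(S ∪ {y})|ₙ − |S|ₙ`. -/
theorem statement15 {n : ℕ} (hn : 2 ≤ n) (S : Set (Euc n))
    (u : Euc n → Euc n) (κ : Euc n → ℝ)
    (hS : IsSymConvexBody S) (hC2 : IsC2Body S u κ)
    (hκ : ∀ x ∈ frontier S, 0 < κ x) :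
    ∃ ψ : ℝ → ℝ, (∀ Δ, 0 ≤ ψ Δ) ∧ Tendsto ψ (𝓝[>] 0) (𝓝 0) ∧
      ∃ Δ₀ > (0:ℝ), ∀ x ∈ frontier S, ∀ Δ : ℝ, 0 < Δ → Δ ≤ Δ₀ →
        ∀ y : Euc n, ⟪x, u x⟫ + Δ ≤ ⟪y, u x⟫ →
          (2*Δ) ^ (((n:ℝ)+1)/2) / ((n:ℝ)*((n:ℝ)+1)) *
              ((volume (ball (0 : Euc (n-1)) 1)).toReal / (κ x) ^ ((1:ℝ)/2)) * (1 - ψ Δ)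
            ≤ (volume (convexHull ℝ (S ∪ {y}))).toReal - (volume S).toReal := by
  obtain ⟨m, rfl⟩ : ∃ m, n = m + 1 := ⟨n - 1, by omega⟩
  obtain ⟨hcomp, -, hint, -⟩ := hS
  obtain ⟨ψ, hψ0, hψ, hbound⟩ := exists_tendsto_zero_of_forall_pos
    (P := fun ε Δ => ∀ x ∈ frontier S, ∀ y, ⟪x, u x⟫ + Δ ≤ ⟪y, u x⟫ →
      capVolume m (κ x ^ ((1 : ℝ) / 2)) Δ * (1 - ε) ≤ excessVolume S y)
    (fun Δ => by
      simp only [ofPred_forall]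
      refine isClosed_iInter fun x => isClosed_iInter fun _ => isClosed_iInter fun y =>
        isClosed_iInter fun _ => isClosed_le (by fun_prop) continuous_const)
    (fun Δ _ x _ y _ => by simpa using excessVolume_nonneg hcomp y)
    (fun ε hε hε1 => by
      obtain ⟨δ, hδ, h⟩ := exists_uniform_capVolume_le (by omega) hcomp hint hC2 hκ hε hε1
      exact ⟨δ, hδ, fun Δ h0 hΔ x hx => h x hx Δ h0 hΔ⟩)
  refine ⟨ψ, hψ0, hψ, 1, one_pos, fun x hx Δ hΔ _ y hy => ?_⟩
  convert hbound Δ hΔ x hx y hy using 2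
  · rw [capVolume, add_tsub_cancel_right, Nat.cast_add_one, add_assoc, one_add_one_eq_two]
  · rfl
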